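/- arXiv:1003.5084 — 5 statements merged into one kernel-verified Lean document; each statement's English description precedes it below -/
import Mathlib

section
/- Let 0 < ε < 1/2 and let h : [0,1] → ℂ be a smooth immersion whose slope h'/|h'| is not constant on [ε,1−ε]. Set P := [0,ε] ∪ [1−ε,1] and let ḡ : P → ℂ be a smooth map such that (h,ḡ) satisfies the stabilization conditions on P. Then there exists a smooth map g : [0,1] → ℂ which agrees with ḡ on P such that (h,g) satisfies the stabilization conditions on [0,1]. -/
/-- The real inner product `⟨z,w⟩ = Re (z · conj w)` on `ℂ ≅ ℝ²`. -/
noncomputable def rinner (z w : ℂ) : ℝ := (z * (starRingEnd ℂ) w).re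

/-- The pair `(h,g)` satisfies the stabilization conditions on `S`:
`⟨g'(r), i·h'(r)⟩ = 0` and `⟨g(r), i·h'(r)⟩ > 0` for all `r ∈ S`. -/
def StabOn (h g : ℝ → ℂ) (S : Set ℝ) : Prop :=
  ∀ r ∈ S, rinner (deriv g r) (Complex.I * deriv h r) = 0 ∧
    0 < rinner (g r) (Complex.I * deriv h r)

section

open Set

lemma exists_smooth_cutoff {a b η : ℝ} (hab : a < b) (hη : 0 < η) :
    ∃ f : ℝ → ℝ, ContDiff ℝ (⊤ : ℕ∞) f ∧ (∀ x, 0 ≤ f x) ∧ (∀ x, f x ≤ 1) ∧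
      (∀ x ∈ Ioo a b, 0 < f x) ∧ (∀ x, x ∉ Ioo a b → f x = 0) ∧
      ∫ x in a..b, (1 - f x) ≤ η := by
  set δ : ℝ := min (η / 2) ((b - a) / 4) with hδ
  have hδη : δ ≤ η / 2 := min_le_left _ _
  have hδab : δ ≤ (b - a) / 4 := min_le_right _ _
  have hδ0 : 0 < δ := lt_min (by linarith) (by linarith)
  let f : ContDiffBump ((a + b) / 2) :=
    ⟨(b - a) / 2 - δ, (b - a) / 2, by linarith, by linarith⟩
  have hball : Metric.ball ((a + b) / 2) f.rOut = Ioo a b := by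
    rw [Real.ball_eq_Ioo]
    congr 1 <;> simp only [f] <;> ring
  have hcont : Continuous fun x => 1 - f x := continuous_const.sub f.continuous
  refine ⟨f, f.contDiff, fun x => f.nonneg, fun x => f.le_one, ?_, ?_, ?_⟩
  · intro x hx
    exact f.pos_of_mem_ball (hball ▸ hx)
  · intro x hx
    rw [← hball, ← f.support_eq] at hx
    exact Function.notMem_support.1 hx
  · have hle : ∀ x y : ℝ, x ≤ y → ∫ t in x..y, (1 - f t) ≤ y - x := by
      intro x y hxy
      have := intervalIntegral.integral_mono_on (μ := MeasureTheory.volume) hxy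
        (hcont.intervalIntegrable x y) (continuous_const.intervalIntegrable x y)
        (g := fun _ => (1 : ℝ)) (fun t _ => by linarith [f.nonneg (x := t)])
      simpa using this
    have hzero : ∫ t in (a + δ)..(b - δ), (1 - f t) = 0 := by
      refine intervalIntegral.integral_zero_ae (Filter.Eventually.of_forall fun t ht => ?_)
      rw [uIoc_of_le (by linarith)] at ht
      have : f t = 1 := f.one_of_mem_closedBall (by
        rw [Real.closedBall_eq_Icc]
        constructor <;> simp only [f] <;> linarith [ht.1, ht.2])
      rw [this, sub_self]
    rw [← intervalIntegral.integral_add_adjacent_intervals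
        (hcont.intervalIntegrable a (a + δ)) (hcont.intervalIntegrable (a + δ) b),
      ← intervalIntegral.integral_add_adjacent_intervals
        (hcont.intervalIntegrable (a + δ) (b - δ)) (hcont.intervalIntegrable (b - δ) b), hzero]
    linarith [hle a (a + δ) (by linarith), hle (b - δ) b (by linarith)]

lemma eqOn_Icc_of_hasDerivAt_eq {F G F' : ℝ → ℝ} {x y z : ℝ}
    (hF : ∀ r ∈ Icc x y, HasDerivAt F (F' r) r) (hG : ∀ r ∈ Icc x y, HasDerivAt G (F' r) r)
    (hz : z ∈ Icc x y) (hFG : F z = G z) : EqOn F G (Icc x y) := by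
  have hd : ∀ r ∈ Icc x y, HasDerivAt (fun t => F t - G t) 0 r := fun r hr =>
    ((hF r hr).sub (hG r hr)).congr_deriv (sub_self _)
  have hconst := constant_of_has_deriv_right_zero
    (fun r hr => (hd r hr).continuousAt.continuousWithinAt)
    (fun r hr => (hd r (Ico_subset_Icc_self hr)).hasDerivWithinAt)
  intro r hr
  have h1 := hconst r hr
  have h2 := hconst z hz
  linarith

lemma contDiff_of_hasDerivAt {F F' : ℝ → ℝ} (hF' : ContDiff ℝ (⊤ : ℕ∞) F')
    (hF : ∀ r, HasDerivAt F (F' r) r) : ContDiff ℝ (⊤ : ℕ∞) F := by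
  rw [contDiff_infty_iff_deriv]
  exact ⟨fun r => (hF r).differentiableAt, by rwa [funext fun r => (hF r).deriv]⟩

/-- Solve `p' = -q W` with `p > 0` and prescribed `p`, `q` near the two ends. -/
lemma exists_pos_solution_extension {a b c d : ℝ} (hca : c ≤ a) (hab : a < b) (hbd : b ≤ d)
    {p₀ q₀ W : ℝ → ℝ} (hq₀ : ContDiff ℝ (⊤ : ℕ∞) q₀) (hW : ContDiff ℝ (⊤ : ℕ∞) W)
    (hode : ∀ r ∈ Icc c a ∪ Icc b d, HasDerivAt p₀ (-(q₀ r * W r)) r)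
    (hpos : ∀ r ∈ Icc c a ∪ Icc b d, 0 < p₀ r) (hne : ∃ r ∈ Ioo a b, W r ≠ 0) :
    ∃ p q : ℝ → ℝ, ContDiff ℝ (⊤ : ℕ∞) p ∧ ContDiff ℝ (⊤ : ℕ∞) q ∧
      EqOn p p₀ (Icc c a ∪ Icc b d) ∧ EqOn q q₀ (Icc c a ∪ Icc b d) ∧
      (∀ r, HasDerivAt p (-(q r * W r)) r) ∧ ∀ r ∈ Icc c d, 0 < p r := by
  have hpa : 0 < p₀ a := hpos a (Or.inl ⟨hca, le_rfl⟩)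
  have hpb : 0 < p₀ b := hpos b (Or.inr ⟨le_rfl, hbd⟩)
  set m := min (p₀ a) (p₀ b) with hm
  have hm0 : 0 < m := lt_min hpa hpb
  obtain ⟨M, hM⟩ := (isCompact_Icc (a := a) (b := b)).exists_bound_of_continuousOn
    (hq₀.continuous.mul hW.continuous).continuousOn
  have hM0 : 0 ≤ M := (norm_nonneg _).trans (hM a ⟨le_rfl, hab.le⟩)
  obtain ⟨f, hf, hf0, hf1, hfpos, hfz, hfint⟩ :=
    exists_smooth_cutoff hab (show 0 < m / (4 * (M + 1)) by positivity)
  have hcutA : ContDiff ℝ (⊤ : ℕ∞) fun x => (1 - f x) * (q₀ x * W x) :=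
    (contDiff_const.sub hf).mul (hq₀.mul hW)
  have hcutB : ContDiff ℝ (⊤ : ℕ∞) fun x => f x * W x ^ 2 := hf.mul (hW.pow 2)
  set A : ℝ → ℝ := fun r => ∫ x in a..r, (1 - f x) * (q₀ x * W x) with hA
  set B : ℝ → ℝ := fun r => ∫ x in a..r, f x * W x ^ 2 with hB
  have dA : ∀ r, HasDerivAt A ((1 - f r) * (q₀ r * W r)) r := fun r =>
    (hcutA.continuous.integral_hasStrictDerivAt a r).hasDerivAt
  have dB : ∀ r, HasDerivAt B (f r * W r ^ 2) r := fun r =>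
    (hcutB.continuous.integral_hasStrictDerivAt a r).hasDerivAt
  have Aa : A a = 0 := intervalIntegral.integral_same
  have Ba : B a = 0 := intervalIntegral.integral_same
  have hc1 : Continuous fun x => 1 - f x := continuous_const.sub hf.continuous
  have hAbd : ∀ r ∈ Icc a b, |A r| ≤ m / 4 := by
    intro r hr
    have h1 : |A r| ≤ ∫ x in a..r, ‖(1 - f x) * (q₀ x * W x)‖ :=
      intervalIntegral.norm_integral_le_integral_norm (μ := MeasureTheory.volume)
        (f := fun x => (1 - f x) * (q₀ x * W x)) hr.1
    have h2 : ∫ x in a..r, ‖(1 - f x) * (q₀ x * W x)‖ ≤ ∫ x in a..r, (1 - f x) * M := by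
      refine intervalIntegral.integral_mono_on hr.1
        (hcutA.continuous.norm.intervalIntegrable _ _)
        ((hc1.mul continuous_const).intervalIntegrable _ _) fun x hx => ?_
      rw [norm_mul, Real.norm_of_nonneg (by linarith [hf1 x])]
      exact mul_le_mul_of_nonneg_left (hM x ⟨hx.1, hx.2.trans hr.2⟩) (by linarith [hf1 x])
    have h3 : ∫ x in a..r, (1 - f x) ≤ ∫ x in a..b, (1 - f x) :=
      intervalIntegral.integral_mono_interval le_rfl hr.1 hr.2
        (Filter.Eventually.of_forall fun x => by simpa using hf1 x)
        (hc1.intervalIntegrable _ _)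
    rw [intervalIntegral.integral_mul_const] at h2
    have h4 : (∫ x in a..r, (1 - f x)) * M ≤ m / (4 * (M + 1)) * M :=
      mul_le_mul_of_nonneg_right (h3.trans hfint) hM0
    have h5 : m / (4 * (M + 1)) * M ≤ m / 4 := by
      rw [div_mul_eq_mul_div, div_le_div_iff₀ (by positivity) (by positivity)]
      nlinarith
    linarith
  have hBb : 0 < B b := by
    obtain ⟨r, hr, hWr⟩ := hne
    refine intervalIntegral.integral_pos hab hcutB.continuous.continuousOn
      (fun x _ => mul_nonneg (hf0 x) (sq_nonneg _)) ⟨r, Ioo_subset_Icc_self hr, ?_⟩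
    have := hfpos r hr
    positivity
  have hBmem : ∀ r ∈ Icc a b, 0 ≤ B r ∧ B r ≤ B b := by
    intro r hr
    refine ⟨intervalIntegral.integral_nonneg hr.1 fun x _ => mul_nonneg (hf0 x) (sq_nonneg _), ?_⟩
    exact intervalIntegral.integral_mono_interval le_rfl hr.1 hr.2
        (Filter.Eventually.of_forall fun x => mul_nonneg (hf0 x) (sq_nonneg _))
        (hcutB.continuous.intervalIntegrable _ _)
  set κ : ℝ := (p₀ a - p₀ b - A b) / B b with hκ
  set q : ℝ → ℝ := fun r => (1 - f r) * q₀ r + κ * (f r * W r) with hq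
  set p : ℝ → ℝ := fun r => p₀ a - A r - κ * B r with hp
  have hqs : ContDiff ℝ (⊤ : ℕ∞) q :=
    ((contDiff_const.sub hf).mul hq₀).add (contDiff_const.mul (hf.mul hW))
  have dp : ∀ r, HasDerivAt p (-(q r * W r)) r := by
    intro r
    refine (((dA r).const_sub (p₀ a)).sub ((dB r).const_mul κ)).congr_deriv ?_
    simp only [hq]; ring
  have hqP : EqOn q q₀ (Icc c a ∪ Icc b d) := by
    intro r hr
    have : f r = 0 := hfz r (by
      rintro ⟨h1, h2⟩
      rcases hr with hr | hr
      · exact absurd hr.2 (not_le.2 h1)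
      · exact absurd hr.1 (not_le.2 h2))
    simp [hq, this]
  have pa : p a = p₀ a := by simp [hp, Aa, Ba]
  have pb : p b = p₀ b := by
    simp only [hp, hκ]; field_simp; ring
  have hpP : EqOn p p₀ (Icc c a ∪ Icc b d) := by
    have key : ∀ r ∈ Icc c a ∪ Icc b d, HasDerivAt p₀ (-(q r * W r)) r := fun r hr => by
      rw [hqP hr]; exact hode r hr
    rintro r (hr | hr)
    · exact eqOn_Icc_of_hasDerivAt_eq (fun r _ => dp r) (fun r hr => key r (Or.inl hr))
        ⟨hca, le_rfl⟩ pa hr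
    · exact eqOn_Icc_of_hasDerivAt_eq (fun r _ => dp r) (fun r hr => key r (Or.inr hr))
        ⟨le_rfl, hbd⟩ pb hr
  refine ⟨p, q, contDiff_of_hasDerivAt (hqs.mul hW).neg dp, hqs, hpP, hqP, dp, fun r hr => ?_⟩
  rcases le_or_gt r a with hra | hra
  · rw [hpP (Or.inl ⟨hr.1, hra⟩)]; exact hpos r (Or.inl ⟨hr.1, hra⟩)
  rcases le_or_gt b r with hbr | hbr
  · rw [hpP (Or.inr ⟨hbr, hr.2⟩)]; exact hpos r (Or.inr ⟨hbr, hr.2⟩)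
  have hrI : r ∈ Icc a b := ⟨hra.le, hbr.le⟩
  obtain ⟨hB0, hB1⟩ := hBmem r hrI
  set s := B r / B b with hs
  have hs0 : 0 ≤ s := div_nonneg hB0 hBb.le
  have hs1 : s ≤ 1 := (div_le_one hBb).2 hB1
  have hpr : p r = (1 - s) * p₀ a + s * p₀ b - A r + s * A b := by
    simp only [hp, hκ, hs]; field_simp; ring
  have hA1 := abs_le.1 (hAbd r hrI)
  have hA2 := abs_le.1 (hAbd b ⟨hab.le, le_rfl⟩)
  rw [hpr]
  nlinarith [min_le_left (p₀ a) (p₀ b), min_le_right (p₀ a) (p₀ b),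
    mul_nonneg hs0 (sub_nonneg.2 (min_le_right (p₀ a) (p₀ b))),
    mul_nonneg (sub_nonneg.2 hs1) (sub_nonneg.2 (min_le_left (p₀ a) (p₀ b))),
    mul_nonneg hs0 (show 0 ≤ A b + m / 4 by linarith)]

/-- Real-coordinate form of the extension statement for a unit frame `(a, b)` on `[c, d]`. -/
lemma exists_stabilizing_extension_of_frame {c l u d : ℝ} (hcl : c < l) (hlu : l < u)
    (hud : u < d) {a b x y : ℝ → ℝ} (ha : ContDiff ℝ (⊤ : ℕ∞) a) (hb : ContDiff ℝ (⊤ : ℕ∞) b)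
    (hx : ContDiff ℝ (⊤ : ℕ∞) x) (hy : ContDiff ℝ (⊤ : ℕ∞) y)
    (hunit : ∀ r ∈ Icc c d, a r ^ 2 + b r ^ 2 = 1)
    (hnc : ∃ r₁ ∈ Icc l u, ∃ r₂ ∈ Icc l u, a r₁ ≠ a r₂ ∨ b r₁ ≠ b r₂)
    (hstab : ∀ r ∈ Icc c l ∪ Icc u d,
      deriv y r * a r - deriv x r * b r = 0 ∧ 0 < y r * a r - x r * b r) :
    ∃ X Y : ℝ → ℝ, ContDiff ℝ (⊤ : ℕ∞) X ∧ ContDiff ℝ (⊤ : ℕ∞) Y ∧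
      EqOn X x (Icc c l ∪ Icc u d) ∧ EqOn Y y (Icc c l ∪ Icc u d) ∧
      ∀ r ∈ Icc c d, deriv Y r * a r - deriv X r * b r = 0 ∧ 0 < Y r * a r - X r * b r := by
  have hP : Icc c l ∪ Icc u d ⊆ Icc c d :=
    union_subset (Icc_subset_Icc_right (by linarith)) (Icc_subset_Icc_left (by linarith))
  have ha' := (contDiff_infty_iff_deriv.1 ha).2
  have hb' := (contDiff_infty_iff_deriv.1 hb).2
  have da : ∀ r, HasDerivAt a (deriv a r) r := fun r =>
    ((contDiff_infty_iff_deriv.1 ha).1 r).hasDerivAt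
  have db : ∀ r, HasDerivAt b (deriv b r) r := fun r =>
    ((contDiff_infty_iff_deriv.1 hb).1 r).hasDerivAt
  have dx : ∀ r, HasDerivAt x (deriv x r) r := fun r =>
    ((contDiff_infty_iff_deriv.1 hx).1 r).hasDerivAt
  have dy : ∀ r, HasDerivAt y (deriv y r) r := fun r =>
    ((contDiff_infty_iff_deriv.1 hy).1 r).hasDerivAt
  set W : ℝ → ℝ := fun r => a r * deriv b r - deriv a r * b r with hW
  have hWs : ContDiff ℝ (⊤ : ℕ∞) W := (ha.mul hb').sub (ha'.mul hb)
  have horth : ∀ r ∈ Icc c d, a r * deriv a r + b r * deriv b r = 0 := by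
    have hIoo : EqOn (fun r => a r * deriv a r + b r * deriv b r) (fun _ => 0) (Ioo c d) := by
      intro r hr
      have h1 : HasDerivAt (fun t => a t ^ 2 + b t ^ 2) 0 r := by
        refine (hasDerivAt_const r (1 : ℝ)).congr_of_eventuallyEq ?_
        filter_upwards [Icc_mem_nhds hr.1 hr.2] with t ht using hunit t ht
      have h2 := (((da r).pow 2).add ((db r).pow 2)).unique h1
      norm_num at h2
      simp only
      linarith
    have := hIoo.closure ((ha.continuous.mul ha'.continuous).add
      (hb.continuous.mul hb'.continuous)) continuous_const
    rwa [closure_Ioo (by linarith : c < d).ne] at this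
  have hda : ∀ r ∈ Icc c d, deriv a r = -(W r * b r) := fun r hr => by
    simp only [hW]
    linear_combination (-deriv a r) * hunit r hr + a r * horth r hr
  have hdb : ∀ r ∈ Icc c d, deriv b r = W r * a r := fun r hr => by
    simp only [hW]
    linear_combination (-deriv b r) * hunit r hr + b r * horth r hr
  have hne : ∃ r ∈ Ioo l u, W r ≠ 0 := by
    by_contra! hcon
    have hW0 : EqOn W (fun _ => 0) (Icc l u) := by
      have := EqOn.closure (f := W) (g := fun _ => 0) hcon hWs.continuous continuous_const
      rwa [closure_Ioo hlu.ne] at this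
    have hsub : Icc l u ⊆ Icc c d := Icc_subset_Icc hcl.le hud.le
    obtain ⟨r₁, h₁, r₂, h₂, h⟩ := hnc
    rcases h with h | h
    · exact h (eqOn_Icc_of_hasDerivAt_eq (F' := fun _ => 0)
        (fun r hr => (da r).congr_deriv (by rw [hda r (hsub hr), hW0 hr]; simp))
        (fun r _ => hasDerivAt_const r (a r₂)) h₂ rfl h₁)
    · exact h (eqOn_Icc_of_hasDerivAt_eq (F' := fun _ => 0)
        (fun r hr => (db r).congr_deriv (by rw [hdb r (hsub hr), hW0 hr]; simp))
        (fun r _ => hasDerivAt_const r (b r₂)) h₂ rfl h₁)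
  obtain ⟨p, q, hp, hq, hpe, hqe, dp, hppos⟩ := exists_pos_solution_extension hcl.le hlu hud.le
    (p₀ := fun r => y r * a r - x r * b r) (q₀ := fun r => x r * a r + y r * b r)
    ((hx.mul ha).add (hy.mul hb)) hWs
    (fun r hr => ((((dy r).mul (da r)).sub ((dx r).mul (db r)))).congr_deriv (by
      rw [hda r (hP hr), hdb r (hP hr)]
      linear_combination (hstab r hr).1))
    (fun r hr => (hstab r hr).2) hne
  have dq : ∀ r, HasDerivAt q (deriv q r) r := fun r =>
    ((contDiff_infty_iff_deriv.1 hq).1 r).hasDerivAt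
  refine ⟨fun r => q r * a r - p r * b r, fun r => q r * b r + p r * a r,
    (hq.mul ha).sub (hp.mul hb), (hq.mul hb).add (hp.mul ha), ?_, ?_, ?_⟩
  · intro r hr
    simp only [hpe hr, hqe hr]
    linear_combination x r * hunit r (hP hr)
  · intro r hr
    simp only [hpe hr, hqe hr]
    linear_combination y r * hunit r (hP hr)
  · intro r hr
    have h1 := (((dq r).mul (da r)).sub ((dp r).mul (db r))).deriv
    have h2 := (((dq r).mul (db r)).add ((dp r).mul (da r))).deriv
    constructor
    · erw [h1, h2]
      rw [hda r hr, hdb r hr]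
      ring
    · have := hppos r hr
      have h3 : (q r * b r + p r * a r) * a r - (q r * a r - p r * b r) * b r = p r := by
        linear_combination p r * hunit r hr
      simpa only [h3] using this

lemma exists_smooth_pos_extension {c d : ℝ} {m : ℝ → ℝ} (hm : ContDiff ℝ (⊤ : ℕ∞) m)
    (hm0 : ∀ r, 0 ≤ m r) (hpos : ∀ r ∈ Icc c d, 0 < m r) :
    ∃ M : ℝ → ℝ, ContDiff ℝ (⊤ : ℕ∞) M ∧ (∀ r, 0 < M r) ∧ EqOn M m (Icc c d) := by
  refine ⟨fun r => m r + (expNegInvGlue (c - r) + expNegInvGlue (r - d)),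
    hm.add ((expNegInvGlue.contDiff.comp (contDiff_const.sub contDiff_id)).add
      (expNegInvGlue.contDiff.comp (contDiff_id.sub contDiff_const))), fun r => ?_, fun r hr => ?_⟩
  · have h1 := expNegInvGlue.nonneg (c - r)
    have h2 := expNegInvGlue.nonneg (r - d)
    have h3 := hm0 r
    by_cases hr : r ∈ Icc c d
    · linarith [hpos r hr]
    · rcases not_and_or.1 hr with h | h
      · linarith [expNegInvGlue.pos_of_pos (sub_pos.2 (not_le.1 h))]
      · linarith [expNegInvGlue.pos_of_pos (sub_pos.2 (not_le.1 h))]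
  · simp [expNegInvGlue.zero_of_nonpos (sub_nonpos.2 hr.1),
      expNegInvGlue.zero_of_nonpos (sub_nonpos.2 hr.2)]

lemma rinner_I_mul (z w : ℂ) : rinner z (Complex.I * w) = z.im * w.re - z.re * w.im := by
  simp [rinner]

lemma contDiff_re {f : ℝ → ℂ} (hf : ContDiff ℝ (⊤ : ℕ∞) f) :
    ContDiff ℝ (⊤ : ℕ∞) fun r => (f r).re := Complex.reCLM.contDiff.comp hf

lemma contDiff_im {f : ℝ → ℂ} (hf : ContDiff ℝ (⊤ : ℕ∞) f) :
    ContDiff ℝ (⊤ : ℕ∞) fun r => (f r).im := Complex.imCLM.contDiff.comp hf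

lemma deriv_re_of_differentiableAt {f : ℝ → ℂ} {r : ℝ} (hf : DifferentiableAt ℝ f r) :
    deriv (fun t => (f t).re) r = (deriv f r).re :=
  (Complex.reCLM.hasFDerivAt.comp_hasDerivAt r hf.hasDerivAt).deriv

lemma deriv_im_of_differentiableAt {f : ℝ → ℂ} {r : ℝ} (hf : DifferentiableAt ℝ f r) :
    deriv (fun t => (f t).im) r = (deriv f r).im :=
  (Complex.imCLM.hasFDerivAt.comp_hasDerivAt r hf.hasDerivAt).deriv

end

/-- Proposition on stabilization for nonconstant slope: boundary
stabilizing data `ḡ` on `P = [0,ε] ∪ [1−ε,1]` extends to a stabilizing map `g`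
on all of `[0,1]`, provided the slope of `h` is nonconstant on `[ε,1−ε]`. -/
theorem stmt9 (ε : ℝ) (hε0 : 0 < ε) (hε : ε < 1/2)
    (h gbar : ℝ → ℂ)
    (h_sm : ContDiff ℝ (⊤ : ℕ∞) h) (gbar_sm : ContDiff ℝ (⊤ : ℕ∞) gbar)
    (himm : ∀ r ∈ Set.Icc (0:ℝ) 1, deriv h r ≠ 0)
    (hnc : ∃ r₁ ∈ Set.Icc ε (1 - ε), ∃ r₂ ∈ Set.Icc ε (1 - ε),
      deriv h r₁ / (‖deriv h r₁‖ : ℂ) ≠ deriv h r₂ / (‖deriv h r₂‖ : ℂ))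
    (hstab : StabOn h gbar (Set.Icc 0 ε ∪ Set.Icc (1 - ε) 1)) :
    ∃ g : ℝ → ℂ, ContDiff ℝ (⊤ : ℕ∞) g ∧
      Set.EqOn g gbar (Set.Icc 0 ε ∪ Set.Icc (1 - ε) 1) ∧
      StabOn h g (Set.Icc 0 1) := by
  have hv := (contDiff_infty_iff_deriv.1 h_sm).2
  have hv1 := contDiff_re hv
  have hv2 := contDiff_im hv
  obtain ⟨M, hM, hMpos, hMe⟩ := exists_smooth_pos_extension (c := 0) (d := 1)
    (m := fun r => (deriv h r).re ^ 2 + (deriv h r).im ^ 2) ((hv1.pow 2).add (hv2.pow 2))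
    (fun r => by positivity) (fun r hr => by
      have := Complex.normSq_pos.2 (himm r hr)
      rw [Complex.normSq_apply] at this
      linarith)
  have hN : ContDiff ℝ (⊤ : ℕ∞) fun r => √(M r) := hM.sqrt fun r => (hMpos r).ne'
  have hNpos : ∀ r, 0 < √(M r) := fun r => Real.sqrt_pos.2 (hMpos r)
  have hNnorm : ∀ r ∈ Set.Icc (0 : ℝ) 1, √(M r) = ‖deriv h r‖ := fun r hr => by
    rw [hMe hr, Complex.norm_eq_sqrt_sq_add_sq]
  have hrin : ∀ (z : ℂ) (r : ℝ), rinner z (Complex.I * deriv h r) =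
      √(M r) * (z.im * ((deriv h r).re / √(M r)) - z.re * ((deriv h r).im / √(M r))) := by
    intro z r
    have := (hNpos r).ne'
    rw [rinner_I_mul]
    field_simp
  have hgd : Differentiable ℝ gbar := (contDiff_infty_iff_deriv.1 gbar_sm).1
  obtain ⟨X, Y, hX, hY, hXe, hYe, hXY⟩ := exists_stabilizing_extension_of_frame
    (c := 0) (l := ε) (u := 1 - ε) (d := 1) hε0 (by linarith) (by linarith)
    (a := fun r => (deriv h r).re / √(M r)) (b := fun r => (deriv h r).im / √(M r))
    (hv1.div hN fun r => (hNpos r).ne') (hv2.div hN fun r => (hNpos r).ne')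
    (contDiff_re gbar_sm) (contDiff_im gbar_sm)
    (fun r hr => by
      rw [div_pow, div_pow, Real.sq_sqrt (hMpos r).le, ← add_div]
      exact (div_eq_one_iff_eq (hMpos r).ne').2 (hMe hr).symm)
    (by
      obtain ⟨r₁, h₁, r₂, h₂, hne⟩ := hnc
      refine ⟨r₁, h₁, r₂, h₂, ?_⟩
      by_contra! hcon
      refine hne (Complex.ext ?_ ?_)
      · rw [Complex.div_ofReal_re, Complex.div_ofReal_re,
          ← hNnorm r₁ ⟨by linarith [h₁.1], by linarith [h₁.2]⟩,
          ← hNnorm r₂ ⟨by linarith [h₂.1], by linarith [h₂.2]⟩]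
        exact hcon.1
      · rw [Complex.div_ofReal_im, Complex.div_ofReal_im,
          ← hNnorm r₁ ⟨by linarith [h₁.1], by linarith [h₁.2]⟩,
          ← hNnorm r₂ ⟨by linarith [h₂.1], by linarith [h₂.2]⟩]
        exact hcon.2)
    (fun r hr => by
      obtain ⟨e, hlt⟩ := hstab r hr
      rw [hrin] at e hlt
      rw [deriv_re_of_differentiableAt (hgd r), deriv_im_of_differentiableAt (hgd r)]
      exact ⟨(mul_eq_zero.1 e).resolve_left (hNpos r).ne', pos_of_mul_pos_right hlt (hNpos r).le⟩)
  have hg : ContDiff ℝ (⊤ : ℕ∞) fun r => (⟨X r, Y r⟩ : ℂ) :=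
    Complex.equivRealProdCLM.symm.contDiff.comp (hX.prodMk hY)
  have hgd' := (contDiff_infty_iff_deriv.1 hg).1
  refine ⟨fun r => ⟨X r, Y r⟩, hg, fun r hr => Complex.ext (hXe hr) (hYe hr), fun r hr => ?_⟩
  obtain ⟨e, hlt⟩ := hXY r hr
  rw [hrin, hrin, ← deriv_re_of_differentiableAt (hgd' r), ← deriv_im_of_differentiableAt (hgd' r)]
  exact ⟨mul_eq_zero_of_right _ e, mul_pos (hNpos r) hlt⟩
end

section
/- Let 0 < ε < 1/2 and let u : [0,1] → ℂ be a continuous nowhere-vanishing map such that u/|u| is not constant on [ε,1−ε]. Then the linear map L_u, defined on the space of smooth real-valued functions σ : [0,1] → ℝ with support contained in [ε,1−ε] by L_u(σ) := ∫₀¹ σ(s)·u(s) ds ∈ ℂ, is surjective onto ℂ: for every z ∈ ℂ there exists such a σ with ∫₀¹ σ(s)·u(s) ds = z. -/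
open MeasureTheory Set

/-- A continuous function on `[a, b]` whose integral against every smooth function with support in
`[a, b]` is zero vanishes on `[a, b]`. -/
theorem eqOn_zero_of_forall_integral_smooth_mul_eq_zero {a b : ℝ} (hab : a < b) {g : ℝ → ℝ}
    (hg : ContinuousOn g (Icc a b))
    (h : ∀ σ : ℝ → ℝ, ContDiff ℝ (⊤ : ℕ∞) σ → tsupport σ ⊆ Icc a b → ∫ s, σ s * g s = 0) :
    EqOn g 0 (Icc a b) := by
  have hae : ∀ᵐ x, x ∈ Ioo a b → g x = 0 :=
    isOpen_Ioo.ae_eq_zero_of_integral_contDiff_smul_eq_zero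
      ((hg.mono Ioo_subset_Icc_self).locallyIntegrableOn measurableSet_Ioo)
      fun σ hσ _ hσs => h σ hσ (hσs.trans Ioo_subset_Icc_self)
  refine Measure.eqOn_Icc_of_ae_eq volume hab.ne ?_ hg continuousOn_const
  rw [← restrict_Ioo_eq_restrict_Icc]
  exact (ae_restrict_iff' measurableSet_Ioo).2 hae

/-- A continuous nowhere-vanishing map from a preconnected set to a real line through the origin
in `ℂ` has constant direction. -/
theorem div_norm_eq_div_norm_of_forall_apply_eq_zero {X : Type*} [TopologicalSpace X] {S : Set X}
    (hS : IsPreconnected S) {u : X → ℂ} (hu : ContinuousOn u S) (hu0 : ∀ x ∈ S, u x ≠ 0)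
    {f : ℂ →ₗ[ℝ] ℝ} (hf : f ≠ 0) (hfu : ∀ x ∈ S, f (u x) = 0) {x y : X} (hx : x ∈ S)
    (hy : y ∈ S) : u x / (‖u x‖ : ℂ) = u y / (‖u y‖ : ℂ) := by
  have hfq (q : ℂ) : f (q * u x) = q.im * f (Complex.I * u x) := by
    have : q * u x = q.re • u x + q.im • (Complex.I * u x) := by
      conv_lhs => rw [← Complex.re_add_im q]
      simp only [Complex.real_smul]
      ring
    rw [this, map_add, map_smul, map_smul, hfu x hx]
    simp
  have hfI : f (Complex.I * u x) ≠ 0 := by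
    refine fun h0 => hf (LinearMap.ext fun z => ?_)
    rw [← div_mul_cancel₀ z (hu0 x hx), hfq, h0, mul_zero, LinearMap.zero_apply]
  have him (t : X) (ht : t ∈ S) : (u t / u x).im = 0 := by
    have h := hfq (u t / u x)
    rw [div_mul_cancel₀ _ (hu0 x hx), hfu t ht] at h
    exact (mul_eq_zero.1 h.symm).resolve_right hfI
  have hcont : ContinuousOn (fun t => (u t / u x).re) S :=
    Complex.continuous_re.comp_continuousOn (hu.div_const _)
  have hpos : 0 < (u y / u x).re := by
    by_contra! hle
    obtain ⟨t, ht, h0⟩ := hS.intermediate_value hy hx hcont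
      (show (0 : ℝ) ∈ Icc (u y / u x).re (u x / u x).re by
        simp [div_self (hu0 x hx), hle])
    exact div_ne_zero (hu0 t ht) (hu0 x hx) (Complex.ext h0 (him t ht))
  have hxy : u y = ((u y / u x).re : ℂ) * u x := by
    rw [show ((u y / u x).re : ℂ) = u y / u x from Complex.ext rfl (him y hy).symm,
      div_mul_cancel₀ _ (hu0 x hx)]
  have hc : ((u y / u x).re : ℂ) ≠ 0 := Complex.ofReal_ne_zero.2 hpos.ne'
  rw [hxy, norm_mul, Complex.norm_real, Real.norm_of_nonneg hpos.le, Complex.ofReal_mul,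
    mul_div_mul_left _ _ hc]

/-- The real subspace of `ℂ` formed by the integrals `∫₀¹ σ(s)·u(s) ds`, for `σ` smooth with
support in `[a, b]`. -/
def smoothIntegrals (a b : ℝ) (u : ℝ → ℂ) (hu : ContinuousOn u (Icc 0 1)) : Submodule ℝ ℂ where
  carrier := {z | ∃ σ : ℝ → ℝ, ContDiff ℝ (⊤ : ℕ∞) σ ∧ tsupport σ ⊆ Icc a b ∧
    ∫ s in (0:ℝ)..1, (σ s : ℂ) * u s = z}
  zero_mem' := ⟨0, contDiff_const, by simp [tsupport], by simp⟩
  add_mem' := by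
    rintro _ _ ⟨σ, hσ, hσs, rfl⟩ ⟨τ, hτ, hτs, rfl⟩
    have hint (ρ : ℝ → ℝ) (hρ : ContDiff ℝ (⊤ : ℕ∞) ρ) :
        IntervalIntegrable (fun s => (ρ s : ℂ) * u s) volume 0 1 :=
      ((Complex.continuous_ofReal.comp hρ.continuous).continuousOn.mul
        hu).intervalIntegrable_of_Icc zero_le_one
    refine ⟨σ + τ, hσ.add hτ, (tsupport_add σ τ).trans (union_subset hσs hτs), ?_⟩
    rw [← intervalIntegral.integral_add (hint σ hσ) (hint τ hτ)]
    simp [add_mul]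
  smul_mem' := by
    rintro c _ ⟨σ, hσ, hσs, rfl⟩
    refine ⟨fun s => c * σ s, contDiff_const.mul hσ,
      (tsupport_mul_subset_right (f := fun _ => c)).trans hσs, ?_⟩
    rw [← intervalIntegral.integral_smul]
    simp [mul_assoc]

/-- surjectivity of the map `σ ↦ ∫₀¹ σ(s)·u(s) ds` on smooth
real functions supported in `[ε,1−ε]`, for a continuous nowhere-vanishing
`u : [0,1] → ℂ` whose direction `u/|u|` is not constant on `[ε,1−ε]`. -/
theorem stmt12 (ε : ℝ) (hε0 : 0 < ε) (hε : ε < 1/2)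
    (u : ℝ → ℂ) (hu : ContinuousOn u (Set.Icc 0 1))
    (hunz : ∀ r ∈ Set.Icc (0:ℝ) 1, u r ≠ 0)
    (hnc : ∃ r₁ ∈ Set.Icc ε (1 - ε), ∃ r₂ ∈ Set.Icc ε (1 - ε),
      u r₁ / (‖u r₁‖ : ℂ) ≠ u r₂ / (‖u r₂‖ : ℂ)) :
    ∀ z : ℂ, ∃ σ : ℝ → ℝ, ContDiff ℝ (⊤ : ℕ∞) σ ∧
      tsupport σ ⊆ Set.Icc ε (1 - ε) ∧
      ∫ s in (0:ℝ)..1, (σ s : ℂ) * u s = z := by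
  suffices htop : smoothIntegrals ε (1 - ε) u hu = ⊤ from
    fun z => htop.ge (Submodule.mem_top (x := z))
  by_contra hne
  obtain ⟨f, hf, hker⟩ := Submodule.exists_le_ker_of_lt_top _ (lt_top_iff_ne_top.2 hne)
  obtain ⟨r₁, hr₁, r₂, hr₂, hr⟩ := hnc
  have hsub : Icc ε (1 - ε) ⊆ Ioc 0 1 := fun s hs => ⟨hε0.trans_le hs.1, by linarith [hs.2]⟩
  have hsub' : Icc ε (1 - ε) ⊆ Icc 0 1 := hsub.trans Ioc_subset_Icc_self
  have hfc : Continuous f := f.continuous_of_finiteDimensional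
  have hfu : EqOn (fun s => f (u s)) 0 (Icc ε (1 - ε)) := by
    refine eqOn_zero_of_forall_integral_smooth_mul_eq_zero (by linarith)
      (hfc.comp_continuousOn (hu.mono hsub')) fun σ hσ hσs => ?_
    have hint : IntervalIntegrable (fun s => (σ s : ℂ) * u s) volume 0 1 :=
      ((Complex.continuous_ofReal.comp hσ.continuous).continuousOn.mul
        hu).intervalIntegrable_of_Icc zero_le_one
    have h0 : f (∫ s in (0:ℝ)..1, (σ s : ℂ) * u s) = 0 := hker ⟨σ, hσ, hσs, rfl⟩
    have hcomm := f.toContinuousLinearMap.intervalIntegral_comp_comm hint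
    simp only [LinearMap.coe_toContinuousLinearMap', ← Complex.real_smul, map_smul,
      smul_eq_mul] at hcomm
    rw [intervalIntegral.integral_of_le zero_le_one,
      setIntegral_eq_integral_of_forall_compl_eq_zero] at hcomm
    · rw [hcomm]
      simpa only [Complex.real_smul] using h0
    · intro s hs
      rw [image_eq_zero_of_notMem_tsupport fun h => hs (hsub (hσs h)), zero_mul]
  exact hr (div_norm_eq_div_norm_of_forall_apply_eq_zero isPreconnected_Icc (hu.mono hsub')
    (fun s hs => hunz s (hsub' hs)) hf hfu hr₁ hr₂)
end

section
/- Let h₀, h₁ : [0,1] → ℂ be smooth immersions which agree on a neighbourhood of 0 and on a neighbourhood of 1. Then: (i) w(h₀) − w(h₁) ∈ 2π·ℤ; and (ii) there exists a smooth family h_t : [0,1] → ℂ, t ∈ [0,1], of immersions connecting h₀ to h₁ and agreeing with h₀ on a fixed neighbourhood of {0,1} for all t (a regular homotopy rel boundary) if and only if w(h₀) = w(h₁). -/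
open Set Complex
open scoped ContDiff

/-- Two continuous logarithms of the same function on an interval differ by a constant. -/
lemma sub_eq_sub_of_exp_eqOn {a b : ℝ} {f g : ℝ → ℂ} (hf : ContinuousOn f (Icc a b))
    (hg : ContinuousOn g (Icc a b)) (h : ∀ x ∈ Icc a b, exp (f x) = exp (g x))
    {x y : ℝ} (hx : x ∈ Icc a b) (hy : y ∈ Icc a b) : f x - g x = f y - g y := by
  have hpi : (2 * Real.pi * I : ℂ) ≠ 0 := two_pi_I_ne_zero
  have key : ∀ x ∈ Icc a b, ∃ n : ℤ, ((f x - g x) / (2 * Real.pi * I)).re = n := by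
    intro x hx
    obtain ⟨n, hn⟩ := exp_eq_exp_iff_exists_int.1 (h x hx)
    refine ⟨n, ?_⟩
    rw [hn, add_sub_cancel_left, mul_div_cancel_right₀ _ hpi, intCast_re]
  have hd : IsDiscrete (range ((↑) : ℤ → ℝ)) :=
    isDiscrete_iff_discreteTopology.2
      Int.isClosedEmbedding_coe_real.isEmbedding.toHomeomorph.symm.isEmbedding.discreteTopology
  have hc : ContinuousOn (fun x => ((f x - g x) / (2 * Real.pi * I)).re) (Icc a b) :=
    continuous_re.comp_continuousOn ((hf.sub hg).div_const _)
  have hre := isPreconnected_Icc.constant_of_mapsTo hd hc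
    (fun x hx => (key x hx).imp fun n hn => hn.symm) hx hy
  obtain ⟨n, hn⟩ := exp_eq_exp_iff_exists_int.1 (h x hx)
  obtain ⟨m, hm⟩ := exp_eq_exp_iff_exists_int.1 (h y hy)
  simp only [hn, hm, add_sub_cancel_left, mul_div_cancel_right₀ _ hpi, intCast_re] at hre ⊢
  rw [Int.cast_inj.1 hre]

/-- A smooth function that does not vanish on `[0, 1]` has a smooth logarithm there. -/
lemma exists_contDiff_log {g : ℝ → ℂ} (hg : ContDiff ℝ ∞ g) (h0 : ∀ r ∈ Icc (0 : ℝ) 1, g r ≠ 0)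
    {c : ℂ} (hc : exp c = g 0) :
    ∃ F : ℝ → ℂ, ContDiff ℝ ∞ F ∧ F 0 = c ∧ ∀ r ∈ Icc (0 : ℝ) 1, exp (F r) = g r := by
  let ρ : ℝ → ℝ := fun r => expNegInvGlue (-r) + expNegInvGlue (r - 1)
  have hρ : ContDiff ℝ ∞ ρ :=
    (expNegInvGlue.contDiff.comp contDiff_neg).add
      (expNegInvGlue.contDiff.comp (contDiff_id.sub contDiff_const))
  have hρ0 : ∀ r ∈ Icc (0 : ℝ) 1, ρ r = 0 := fun r hr => by
    simp only [ρ]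
    rw [expNegInvGlue.zero_of_nonpos (by linarith [hr.1]),
      expNegInvGlue.zero_of_nonpos (by linarith [hr.2]), add_zero]
  have hpos : ∀ r, 0 < normSq (g r) + ρ r := by
    intro r
    have h1 := expNegInvGlue.nonneg (-r)
    have h2 := expNegInvGlue.nonneg (r - 1)
    have h3 := normSq_nonneg (g r)
    by_cases hr : r ∈ Icc (0 : ℝ) 1
    · have := normSq_pos.2 (h0 r hr)
      simp only [ρ]; linarith
    · rcases not_and_or.1 hr with hr | hr
      · have := expNegInvGlue.pos_of_pos (x := -r) (by linarith)
        simp only [ρ]; linarith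
      · have := expNegInvGlue.pos_of_pos (x := r - 1) (by linarith)
        simp only [ρ]; linarith
  let q : ℝ → ℂ := fun r => deriv g r * (starRingEnd ℂ) (g r) * ((normSq (g r) + ρ r)⁻¹ : ℝ)
  have hg' : ContDiff ℝ ∞ (deriv g) := (contDiff_infty_iff_deriv.1 hg).2
  have hq : ContDiff ℝ ∞ q := by
    refine (hg'.mul (conjCLE.contDiff.comp hg)).mul (ofRealCLM.contDiff.comp (ContDiff.inv ?_
      fun r => (hpos r).ne'))
    refine ContDiff.add ?_ hρ
    simp only [normSq_apply]
    exact ((reCLM.contDiff.comp hg).mul (reCLM.contDiff.comp hg)).add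
      ((imCLM.contDiff.comp hg).mul (imCLM.contDiff.comp hg))
  have hqg : ∀ r ∈ Icc (0 : ℝ) 1, q r * g r = deriv g r := by
    intro r hr
    have : (normSq (g r) : ℂ) ≠ 0 := by exact_mod_cast (normSq_pos.2 (h0 r hr)).ne'
    simp only [q, hρ0 r hr, add_zero]
    rw [ofReal_inv]
    field_simp
    rw [mul_assoc, mul_comm _ (g r), mul_conj]
  let F : ℝ → ℂ := fun r => c + ∫ x in (0 : ℝ)..r, q x
  have hF : ∀ r, HasDerivAt F (q r) r := fun r =>
    (intervalIntegral.integral_hasDerivAt_right (hq.continuous.intervalIntegrable _ _)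
      (hq.continuous.stronglyMeasurableAtFilter _ _) hq.continuous.continuousAt).const_add c
  refine ⟨F, contDiff_infty_iff_deriv.2 ⟨fun r => (hF r).differentiableAt, ?_⟩, by simp [F], ?_⟩
  · rwa [show deriv F = q from funext fun r => (hF r).deriv]
  · intro r hr
    have hd : ∀ r, HasDerivAt g (deriv g r) r := fun r =>
      (hg.differentiable (by simp) r).hasDerivAt
    have hG : ∀ r, HasDerivAt (fun r => g r * exp (-F r))
        (deriv g r * exp (-F r) + g r * (exp (-F r) * -q r)) r := fun r =>
      (hd r).mul (hF r).neg.cexp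
    have := constant_of_has_deriv_right_zero (f := fun r => g r * exp (-F r)) (a := 0) (b := 1)
      (fun r _ => (hG r).continuousAt.continuousWithinAt) (fun r hr => by
        convert (hG r).hasDerivWithinAt using 1
        rw [← hqg r (Ico_subset_Icc_self hr)]; ring) r hr
    simp only [show F 0 = c by simp [F]] at this
    rw [← hc, ← exp_add, add_neg_cancel, exp_zero, exp_neg] at this
    field_simp at this
    exact this.symm

/-- An entire primitive `E` of `(exp w - 1) / w`. -/
lemma exists_primitive_exp_sub_one_div :
    ∃ E : ℂ → ℂ, ContDiff ℝ ∞ E ∧ E 0 = 0 ∧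
      ∃ e : ℂ → ℂ, (∀ w, HasDerivAt E (e w) w) ∧ ∀ w, w * e w = exp w - 1 := by
  have hd : Differentiable ℂ (dslope exp 0) := by
    rw [← differentiableOn_univ, Complex.differentiableOn_dslope Filter.univ_mem]
    exact differentiable_exp.differentiableOn
  obtain ⟨E, hE0, hE⟩ := hd.isExactOn_univ.with_val_at 0 0
  have hE' : Differentiable ℂ E := fun w => (hE w trivial).differentiableAt
  refine ⟨E, hE'.contDiff.restrict_scalars ℝ, hE0, _, fun w => hE w trivial, fun w => ?_⟩
  simpa using sub_smul_dslope exp 0 w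

/-- Functions that agree on a nontrivial closed interval have the same derivative there. -/
lemma deriv_eqOn_Icc {f g : ℝ → ℂ} {a b : ℝ} (hab : a < b) (hf : Differentiable ℝ f)
    (hg : Differentiable ℝ g) (h : EqOn f g (Icc a b)) :
    EqOn (deriv f) (deriv g) (Icc a b) := by
  intro x hx
  have hu := uniqueDiffOn_Icc hab x hx
  rw [← (hf x).derivWithin hu, ← (hg x).derivWithin hu]
  exact derivWithin_congr h (h hx)

/-- A nonvanishing continuous function on the unit square has a continuous logarithm. -/
lemma exists_continuous_log_square {u : ℝ → ℝ → ℂ} (hu : Continuous (Function.uncurry u))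
    (h0 : ∀ t ∈ Icc (0 : ℝ) 1, ∀ r ∈ Icc (0 : ℝ) 1, u t r ≠ 0) :
    ∃ L : ℝ → ℝ → ℂ, Continuous (Function.uncurry L) ∧
      ∀ t ∈ Icc (0 : ℝ) 1, ∀ r ∈ Icc (0 : ℝ) 1, exp (L t r) = u t r := by
  let p : ℝ → ℝ := fun x => projIcc (0 : ℝ) 1 zero_le_one x
  have hp : Continuous p := continuous_subtype_val.comp continuous_projIcc
  let f : C(ℝ × ℝ, ℂ) := ⟨fun x => u (p x.1) (p x.2),
    hu.comp ((hp.comp continuous_fst).prodMk (hp.comp continuous_snd))⟩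
  have hf0 : ∀ x, f x ∈ ({0}ᶜ : Set ℂ) := fun x =>
    h0 _ (projIcc 0 1 zero_le_one x.1).2 _ (projIcc 0 1 zero_le_one x.2).2
  obtain ⟨F, ⟨-, hF⟩, -⟩ := isCoveringMapOn_exp.existsUnique_continuousMap_lifts f (a₀ := 0)
    (exp_log (hf0 0)) hf0
  refine ⟨fun t r => F (t, r), F.continuous, fun t ht r hr => ?_⟩
  have : exp (F (t, r)) = u (p t) (p r) := congrFun hF (t, r)
  simpa only [p, projIcc_of_mem _ ht, projIcc_of_mem _ hr] using this

/-- Adding fast, small oscillations `N⁻¹ Γ(s, r, N r)` to a family of curves `g` keeps the velocity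
close to `∂_r g + ∂_φ Γ`. -/
lemma exists_corrugation_deriv_ne_zero {g : ℝ × ℝ → ℂ} {Γ : ℝ × ℝ × ℝ → ℂ}
    (hg : ContDiff ℝ ∞ g) (hΓ : ContDiff ℝ ∞ Γ)
    (hper : ∀ s r φ, Γ (s, r, φ + 2 * Real.pi) = Γ (s, r, φ))
    (hne : ∀ s ∈ Icc (0 : ℝ) 1, ∀ r ∈ Icc (0 : ℝ) 1, ∀ φ : ℝ,
      deriv (fun r => g (s, r)) r + deriv (fun φ => Γ (s, r, φ)) φ ≠ 0) :
    ∃ N : ℝ, ∀ s ∈ Icc (0 : ℝ) 1, ∀ r ∈ Icc (0 : ℝ) 1,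
      deriv (fun r => g (s, r) + (N⁻¹ : ℝ) * Γ (s, r, N * r)) r ≠ 0 := by
  have hgd : Differentiable ℝ g := hg.differentiable (by simp)
  have hΓd : Differentiable ℝ Γ := hΓ.differentiable (by simp)
  have hgr : ∀ s r, HasDerivAt (fun r => g (s, r)) (fderiv ℝ g (s, r) (0, 1)) r := fun s r =>
    (hgd (s, r)).hasFDerivAt.comp_hasDerivAt r ((hasDerivAt_const r s).prodMk (hasDerivAt_id r))
  have hΓφ : ∀ s r φ, HasDerivAt (fun φ => Γ (s, r, φ)) (fderiv ℝ Γ (s, r, φ) (0, 0, 1)) φ :=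
    fun s r φ => (hΓd (s, r, φ)).hasFDerivAt.comp_hasDerivAt φ
      ((hasDerivAt_const φ s).prodMk ((hasDerivAt_const φ r).prodMk (hasDerivAt_id φ)))
  let P : ℝ × ℝ × ℝ → ℂ := fun x =>
    fderiv ℝ g (x.1, x.2.1) (0, 1) + fderiv ℝ Γ x (0, 0, 1)
  let Q : ℝ × ℝ × ℝ → ℂ := fun x => fderiv ℝ Γ x (0, 1, 0)
  have hg' : Continuous (fderiv ℝ g) := hg.continuous_fderiv (by simp)
  have hΓ' : Continuous (fderiv ℝ Γ) := hΓ.continuous_fderiv (by simp)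
  have hP : Continuous P := by fun_prop
  have hQ : Continuous Q := by fun_prop
  have hperd : ∀ s r φ (n : ℤ), fderiv ℝ Γ (s, r, φ + n * (2 * Real.pi)) = fderiv ℝ Γ (s, r, φ) := by
    intro s r φ n
    have hp : (fun x => Γ (x + (0, 0, n * (2 * Real.pi)))) = Γ := by
      funext ⟨s, r, φ⟩
      have : Function.Periodic (fun φ => Γ (s, r, φ)) (2 * Real.pi) := hper s r
      simpa using this.int_mul n φ
    have := fderiv_comp_add_right (𝕜 := ℝ) (f := Γ) (x := (s, r, φ)) (0, 0, n * (2 * Real.pi))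
    rw [hp] at this
    simpa using this.symm
  let K : Set (ℝ × ℝ × ℝ) := Icc 0 1 ×ˢ Icc 0 1 ×ˢ Icc 0 (2 * Real.pi)
  have hK : IsCompact K := isCompact_Icc.prod (isCompact_Icc.prod isCompact_Icc)
  have hKne : K.Nonempty := ⟨(0, 0, 0), by simp [K, Real.pi_pos.le]⟩
  have hPne : ∀ x ∈ K, P x ≠ 0 := fun x hx => by
    have := hne x.1 hx.1 x.2.1 hx.2.1 x.2.2
    rwa [(hgr _ _).deriv, (hΓφ _ _ _).deriv] at this
  obtain ⟨x₀, hx₀, hmin⟩ := hK.exists_isMinOn hKne hP.norm.continuousOn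
  obtain ⟨C, hC⟩ := hK.exists_bound_of_continuousOn hQ.continuousOn
  have hδ : 0 < ‖P x₀‖ := norm_pos_iff.2 (hPne x₀ hx₀)
  have hC0 : 0 ≤ C := (norm_nonneg _).trans (hC x₀ hx₀)
  have hN : 0 < (C + 1) / ‖P x₀‖ := by positivity
  refine ⟨(C + 1) / ‖P x₀‖, fun s hs r hr => ?_⟩
  set N := (C + 1) / ‖P x₀‖ with hNdef
  have hderiv : HasDerivAt (fun r => g (s, r) + (N⁻¹ : ℝ) * Γ (s, r, N * r))
      (P (s, r, N * r) + (N⁻¹ : ℝ) * Q (s, r, N * r)) r := by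
    have h1 : HasDerivAt (fun r => Γ (s, r, N * r)) (fderiv ℝ Γ (s, r, N * r) (0, 1, N)) r :=
      (hΓd (s, r, N * r)).hasFDerivAt.comp_hasDerivAt r
        ((hasDerivAt_const r s).prodMk ((hasDerivAt_id r).prodMk
          (by simpa using (hasDerivAt_id r).const_mul N)))
    refine ((hgr s r).add (h1.const_mul ((N⁻¹ : ℝ) : ℂ))).congr_deriv ?_
    have h2 : ((0, 1, N) : ℝ × ℝ × ℝ) = (0, 1, 0) + N • (0, 0, 1) := by simp
    rw [h2, map_add, map_smul]
    have : (N : ℂ) ≠ 0 := by exact_mod_cast hN.ne'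
    simp only [P, Q, real_smul, ofReal_inv]
    field_simp
    ring
  rw [hderiv.deriv]
  obtain ⟨n, hn⟩ : ∃ n : ℤ, N * r - n * (2 * Real.pi) ∈ Icc 0 (2 * Real.pi) := by
    have := toIcoMod_mem_Ico Real.two_pi_pos 0 (N * r)
    refine ⟨toIcoDiv Real.two_pi_pos 0 (N * r), ?_⟩
    rw [toIcoMod, zsmul_eq_mul, zero_add] at this
    exact Ico_subset_Icc_self this
  have hfd := hperd s r (N * r - n * (2 * Real.pi)) n
  rw [sub_add_cancel] at hfd
  have hx : (s, r, N * r - n * (2 * Real.pi)) ∈ K := ⟨hs, hr, hn⟩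
  have h3 : ‖P x₀‖ ≤ ‖P (s, r, N * r)‖ := by
    have := isMinOn_iff.1 hmin _ hx
    simpa only [P, hfd] using this
  have h4 : ‖Q (s, r, N * r)‖ ≤ C := by
    have := hC _ hx
    simpa only [Q, hfd] using this
  intro h
  have h5 : ‖P (s, r, N * r)‖ = N⁻¹ * ‖Q (s, r, N * r)‖ := by
    rw [eq_neg_of_add_eq_zero_left h, norm_neg, norm_mul, norm_real, Real.norm_of_nonneg]
    positivity
  have h6 : N⁻¹ * ‖Q (s, r, N * r)‖ ≤ N⁻¹ * C := by gcongr
  have h7 : N⁻¹ * C < ‖P x₀‖ := by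
    rw [hNdef, inv_div, div_mul_eq_mul_div, div_lt_iff₀ (by positivity)]
    nlinarith
  linarith

/-- Immersions that agree near the ends, and whose velocities have logarithms that agree near the
ends, are regularly homotopic rel boundary. -/
lemma exists_regular_homotopy {h₀ h₁ F₀ F₁ : ℝ → ℂ} {τ : ℝ} (hτ : 0 < τ) (hτ1 : τ ≤ 1)
    (h₀_sm : ContDiff ℝ ∞ h₀) (h₁_sm : ContDiff ℝ ∞ h₁)
    (F₀_sm : ContDiff ℝ ∞ F₀) (F₁_sm : ContDiff ℝ ∞ F₁)
    (hF₀ : ∀ r ∈ Icc (0 : ℝ) 1, exp (F₀ r) = deriv h₀ r)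
    (hF₁ : ∀ r ∈ Icc (0 : ℝ) 1, exp (F₁ r) = deriv h₁ r)
    (hh : EqOn h₀ h₁ (Icc 0 τ ∪ Icc (1 - τ) 1)) (hF : EqOn F₀ F₁ (Icc 0 τ ∪ Icc (1 - τ) 1)) :
    ∃ H : ℝ → ℝ → ℂ, ContDiff ℝ ∞ (Function.uncurry H) ∧
      EqOn (H 0) h₀ (Icc 0 1) ∧ EqOn (H 1) h₁ (Icc 0 1) ∧
      (∀ t ∈ Icc (0 : ℝ) 1, ∀ r ∈ Icc (0 : ℝ) 1, deriv (H t) r ≠ 0) ∧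
      (∃ τ : ℝ, 0 < τ ∧ ∀ t ∈ Icc (0 : ℝ) 1, EqOn (H t) h₀ (Icc 0 τ ∪ Icc (1 - τ) 1)) := by
  have hsub : Icc 0 τ ∪ Icc (1 - τ) 1 ⊆ Icc (0 : ℝ) 1 := by
    rintro r (hr | hr)
    · exact ⟨hr.1, hr.2.trans hτ1⟩
    · exact ⟨by linarith [hr.1], hr.2⟩
  have hdh : EqOn (deriv h₀) (deriv h₁) (Icc 0 τ ∪ Icc (1 - τ) 1) := fun r hr => by
    rw [← hF₀ r (hsub hr), ← hF₁ r (hsub hr), hF hr]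
  obtain ⟨E, hE, hE0, e, hEe, he⟩ := exists_primitive_exp_sub_one_div
  let st := Real.smoothTransition
  have hst : ContDiff ℝ ∞ st := Real.smoothTransition.contDiff
  let κ : ℝ → ℝ := fun s => st (3 * s - 1)
  let b : ℝ → ℝ → ℝ := fun s r =>
    1 / 2 * (st (3 * s) * st (3 - 3 * s) * (st (2 * r / τ - 1) * st (2 * (1 - r) / τ - 1)))
  let L : ℝ → ℝ → ℂ := fun s r => F₀ r + κ s * (F₁ r - F₀ r)
  let v : ℝ → ℝ → ℂ := fun s r => deriv h₀ r + κ s * (deriv h₁ r - deriv h₀ r)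
  let z : ℝ → ℝ → ℂ := fun s r => v s r * exp (-L s r) - 1
  let g : ℝ × ℝ → ℂ := fun x => h₀ x.2 + κ x.1 * (h₁ x.2 - h₀ x.2)
  let Γ : ℝ × ℝ × ℝ → ℂ := fun x => exp (L x.1 x.2.1) *
    ((1 + b x.1 x.2.1 * (2 * z x.1 x.2.1)) * (-I * E (2 * z x.1 x.2.1 * exp (I * x.2.2))) +
      I * b x.1 x.2.1 * (exp (-(I * x.2.2)) * exp (2 * z x.1 x.2.1 * exp (I * x.2.2))))
  have h₀'_sm : ContDiff ℝ ∞ (deriv h₀) := (contDiff_infty_iff_deriv.1 h₀_sm).2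
  have h₁'_sm : ContDiff ℝ ∞ (deriv h₁) := (contDiff_infty_iff_deriv.1 h₁_sm).2
  have hof : ContDiff ℝ ∞ ((↑) : ℝ → ℂ) := ofRealCLM.contDiff
  have hκ : ContDiff ℝ ∞ κ := by fun_prop
  have hg : ContDiff ℝ ∞ g := by fun_prop
  have hL : ContDiff ℝ ∞ (Function.uncurry L) := by
    unfold Function.uncurry; fun_prop
  have hb : ContDiff ℝ ∞ (Function.uncurry b) := by
    unfold Function.uncurry; fun_prop
  have hz : ContDiff ℝ ∞ (Function.uncurry z) := by
    unfold Function.uncurry; fun_prop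
  have hx : ContDiff ℝ ∞ (fun x : ℝ × ℝ × ℝ => (x.1, x.2.1)) := by fun_prop
  have hΓ : ContDiff ℝ ∞ Γ := by
    have hL' := hL.comp hx
    have hb' := hb.comp hx
    have hz' := hz.comp hx
    simp only [Function.comp_def, Function.uncurry_apply_pair] at hL' hb' hz'
    fun_prop
  have hκ0 : ∀ s, s ≤ 1 / 3 → κ s = 0 := fun s hs =>
    Real.smoothTransition.zero_of_nonpos (by linarith)
  have hκ1 : ∀ s, 2 / 3 ≤ s → κ s = 1 := fun s hs =>
    Real.smoothTransition.one_of_one_le (by linarith)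
  have hz0 : ∀ s r, r ∈ Icc (0 : ℝ) 1 → s ≤ 1 / 3 → z s r = 0 := fun s r hr hs => by
    simp only [z, v, L, hκ0 s hs, ofReal_zero, zero_mul, add_zero]
    rw [← hF₀ r hr, ← exp_add, add_neg_cancel, exp_zero, sub_self]
  have hz1 : ∀ s r, r ∈ Icc (0 : ℝ) 1 → 2 / 3 ≤ s → z s r = 0 := fun s r hr hs => by
    simp only [z, v, L, hκ1 s hs, ofReal_one, one_mul, add_sub_cancel]
    rw [← hF₁ r hr, ← exp_add, add_neg_cancel, exp_zero, sub_self]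
  have hzτ : ∀ s r, r ∈ Icc 0 τ ∪ Icc (1 - τ) 1 → z s r = 0 := fun s r hr => by
    simp only [z, v, L, ← hF hr, ← hdh hr, sub_self, mul_zero, add_zero]
    rw [← hF₀ r (hsub hr), ← exp_add, add_neg_cancel, exp_zero, sub_self]
  have hbz : ∀ s r, r ∈ Icc (0 : ℝ) 1 → b s r * (2 * z s r) = z s r := by
    intro s r hr
    rcases le_or_gt s (1 / 3) with hs | hs
    · simp [hz0 s r hr hs]
    rcases le_or_gt (2 / 3) s with hs' | hs'
    · simp [hz1 s r hr hs']
    by_cases hrτ : r ∈ Icc 0 τ ∪ Icc (1 - τ) 1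
    · simp [hzτ s r hrτ]
    · have h1 : τ < r := by
        by_contra! h; exact hrτ (Or.inl ⟨hr.1, h⟩)
      have h2 : τ < 1 - r := by
        by_contra! h; exact hrτ (Or.inr ⟨by linarith, hr.2⟩)
      have hb1 : b s r = 1 / 2 := by
        simp only [b, st]
        rw [Real.smoothTransition.one_of_one_le (by linarith),
          Real.smoothTransition.one_of_one_le (by linarith),
          Real.smoothTransition.one_of_one_le, Real.smoothTransition.one_of_one_le]
        · norm_num
        · rw [le_sub_iff_add_le, le_div_iff₀ hτ]; linarith
        · rw [le_sub_iff_add_le, le_div_iff₀ hτ]; linarith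
      rw [hb1]; push_cast; ring
  have hb_le : ∀ s r, |b s r| ≤ 1 / 2 := by
    intro s r
    have h0 := Real.smoothTransition.nonneg
    have h1 := Real.smoothTransition.le_one
    have : 0 ≤ b s r := by
      simp only [b, st]
      have := h0 (3 * s); have := h0 (3 - 3 * s)
      have := h0 (2 * r / τ - 1); have := h0 (2 * (1 - r) / τ - 1)
      positivity
    rw [abs_of_nonneg this]
    refine mul_le_of_le_one_right (by norm_num) (mul_le_one₀ (mul_le_one₀ (h1 _) (h0 _) (h1 _))
      (mul_nonneg (h0 _) (h0 _)) (mul_le_one₀ (h1 _) (h0 _) (h1 _)))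
  have hΓ0 : ∀ s r φ, z s r = 0 → b s r = 0 → Γ (s, r, φ) = 0 := fun s r φ h1 h2 => by
    simp [Γ, h1, h2, hE0]
  have hper : ∀ s r φ, Γ (s, r, φ + 2 * Real.pi) = Γ (s, r, φ) := by
    intro s r φ
    have h1 : exp (I * ((φ + 2 * Real.pi : ℝ) : ℂ)) = exp (I * φ) := by
      rw [← exp_periodic (I * φ)]; congr 1; push_cast; ring
    simp only [Γ, exp_neg, h1]
  have hvz : ∀ s r, v s r = exp (L s r) * (1 + z s r) := fun s r => by
    have := exp_ne_zero (L s r)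
    simp only [z, exp_neg]
    field_simp
    ring
  have hgd : ∀ s r, HasDerivAt (fun r => g (s, r)) (v s r) r := fun s r =>
    have h0 := (h₀_sm.differentiable (by simp) r).hasDerivAt
    have h1 := (h₁_sm.differentiable (by simp) r).hasDerivAt
    h0.add ((h1.sub h0).const_mul (κ s : ℂ))
  have hΓd : ∀ s r, ∀ φ : ℝ, HasDerivAt (fun φ => Γ (s, r, φ)) (exp (L s r) *
      (exp (2 * z s r * exp (I * φ)) * (1 + b s r * exp (-(I * φ))) -
        (1 + b s r * (2 * z s r)))) φ := by
    intro s r φ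
    have h1 : HasDerivAt (fun φ : ℝ => I * (φ : ℂ)) I φ := by
      simpa using (hasDerivAt_id φ).ofReal_comp.const_mul I
    have h2 := h1.cexp.const_mul (2 * z s r)
    have h3 := (hEe (2 * z s r * exp (I * φ))).comp φ h2
    have h4 := h1.neg.cexp.mul h2.cexp
    refine ((((h3.const_mul (-I)).const_mul (1 + b s r * (2 * z s r))).add
      (h4.const_mul (I * b s r))).const_mul (exp (L s r))).congr_deriv ?_
    have h5 := he (2 * z s r * exp (I * φ))
    have h6 : exp (-(I * φ)) * exp (I * φ) = 1 := by rw [← exp_add, neg_add_cancel, exp_zero]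
    have h7 := I_mul_I
    generalize e (2 * z s r * exp (I * φ)) = e' at *
    generalize exp (2 * z s r * exp (I * φ)) = X at *
    generalize exp (-(I * φ)) = w' at *
    generalize exp (I * φ) = w at *
    linear_combination exp (L s r) * ((1 + b s r * (2 * z s r)) * h5 +
      (-(1 + b s r * (2 * z s r)) * e' * (2 * z s r * w) - b s r * w' * X
        + b s r * w' * X * (2 * z s r) * w) * h7 - b s r * X * (2 * z s r) * h6)
  obtain ⟨N, hN⟩ := exists_corrugation_deriv_ne_zero hg hΓ hper (fun s hs r hr φ => by
    rw [(hgd s r).deriv, (hΓd s r φ).deriv, hvz, hbz s r hr]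
    have h1 : 1 + b s r * exp (-(I * φ)) ≠ 0 := by
      intro h
      have h2 : ‖(b s r : ℂ) * exp (-(I * φ))‖ = 1 := by
        rw [eq_neg_of_add_eq_zero_right h]; simp
      have h3 : ‖exp (-(I * φ))‖ = 1 := by
        rw [norm_exp]; simp
      rw [norm_mul, h3, mul_one, norm_real, Real.norm_eq_abs] at h2
      linarith [hb_le s r]
    have := mul_ne_zero (exp_ne_zero (L s r))
      (mul_ne_zero (exp_ne_zero (2 * z s r * exp (I * φ))) h1)
    convert this using 1
    ring)
  refine ⟨fun s r => g (s, r) + (N⁻¹ : ℝ) * Γ (s, r, N * r), ?_, ?_, ?_, hN, τ / 2, by linarith, ?_⟩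
  · unfold Function.uncurry; fun_prop
  · intro r hr
    have hb0 : b 0 r = 0 := by simp [b, st]
    simp [hΓ0 0 r _ (hz0 0 r hr (by norm_num)) hb0, g, hκ0 0 (by norm_num)]
  · intro r hr
    have hb0 : b 1 r = 0 := by simp [b, st]
    simp [hΓ0 1 r _ (hz1 1 r hr (by norm_num)) hb0, g, hκ1 1 (by norm_num)]
  · intro s _ r hr
    have hr' : r ∈ Icc 0 τ ∪ Icc (1 - τ) 1 :=
      hr.imp (fun h => ⟨h.1, by linarith [h.2]⟩) (fun h => ⟨by linarith [h.1], h.2⟩)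
    have hb0 : b s r = 0 := by
      simp only [b, st]
      rcases hr with hr | hr
      · rw [Real.smoothTransition.zero_of_nonpos (x := 2 * r / τ - 1)]
        · ring
        · rw [sub_nonpos, div_le_one hτ]; linarith [hr.2]
      · rw [Real.smoothTransition.zero_of_nonpos (x := 2 * (1 - r) / τ - 1)]
        · ring
        · rw [sub_nonpos, div_le_one hτ]; linarith [hr.1]
    simp [hΓ0 s r _ (hzτ s r hr') hb0, g, hh hr']

/-- The change of a continuous logarithm `F` of `f` is determined by an argument lift of `f`. -/
lemma log_sub_eq_of_lift {f F : ℝ → ℂ} {σ : ℝ → ℝ} (hf : ContinuousOn f (Icc 0 1))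
    (h0 : ∀ r ∈ Icc (0 : ℝ) 1, f r ≠ 0) (hσ : ContinuousOn σ (Icc 0 1))
    (hlift : ∀ r ∈ Icc (0 : ℝ) 1, f r = (‖f r‖ : ℂ) * exp (I * (σ r : ℂ)))
    (hF : ContinuousOn F (Icc 0 1)) (hexp : ∀ r ∈ Icc (0 : ℝ) 1, exp (F r) = f r) :
    F 1 - F 0 = ((Real.log ‖f 1‖ - Real.log ‖f 0‖ : ℝ) : ℂ) + I * ((σ 1 - σ 0 : ℝ) : ℂ) := by
  have hG : ContinuousOn (fun r => (Real.log ‖f r‖ : ℂ) + I * (σ r : ℂ)) (Icc 0 1) :=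
    (continuous_ofReal.comp_continuousOn (hf.norm.log fun r hr => norm_ne_zero_iff.2 (h0 r hr))).add
      (continuousOn_const.mul (continuous_ofReal.comp_continuousOn hσ))
  have := sub_eq_sub_of_exp_eqOn hF hG (fun r hr => by
    rw [hexp r hr, exp_add, ← ofReal_exp, Real.exp_log (norm_pos_iff.2 (h0 r hr))]
    exact hlift r hr) (right_mem_Icc.2 zero_le_one) (left_mem_Icc.2 zero_le_one)
  push_cast at this ⊢
  linear_combination this

/-- for immersions `h₀, h₁ : [0,1] → ℂ` agreeing near `0` and
near `1`: (i) their winding numbers differ by an integer multiple of `2π`;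
(ii) they are regularly homotopic rel boundary iff the winding numbers are
equal. -/
theorem stmt16 (h₀ h₁ : ℝ → ℂ)
    (h₀_sm : ContDiff ℝ (⊤ : ℕ∞) h₀) (h₁_sm : ContDiff ℝ (⊤ : ℕ∞) h₁)
    (himm0 : ∀ r ∈ Set.Icc (0:ℝ) 1, deriv h₀ r ≠ 0)
    (himm1 : ∀ r ∈ Set.Icc (0:ℝ) 1, deriv h₁ r ≠ 0)
    (heq : ∃ τ : ℝ, 0 < τ ∧ Set.EqOn h₀ h₁ (Set.Icc 0 τ ∪ Set.Icc (1 - τ) 1))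
    (σ₀ σ₁ : ℝ → ℝ)
    (hσ₀c : ContinuousOn σ₀ (Set.Icc 0 1)) (hσ₁c : ContinuousOn σ₁ (Set.Icc 0 1))
    (hlift0 : ∀ r ∈ Set.Icc (0:ℝ) 1,
      deriv h₀ r = (‖deriv h₀ r‖ : ℂ) * Complex.exp (Complex.I * (σ₀ r : ℂ)))
    (hlift1 : ∀ r ∈ Set.Icc (0:ℝ) 1,
      deriv h₁ r = (‖deriv h₁ r‖ : ℂ) * Complex.exp (Complex.I * (σ₁ r : ℂ))) :
    (∃ m : ℤ, (σ₀ 1 - σ₀ 0) - (σ₁ 1 - σ₁ 0) = 2 * Real.pi * m) ∧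
    ((∃ H : ℝ → ℝ → ℂ, ContDiff ℝ (⊤ : ℕ∞) (Function.uncurry H) ∧
        Set.EqOn (H 0) h₀ (Set.Icc 0 1) ∧
        Set.EqOn (H 1) h₁ (Set.Icc 0 1) ∧
        (∀ t ∈ Set.Icc (0:ℝ) 1, ∀ r ∈ Set.Icc (0:ℝ) 1, deriv (H t) r ≠ 0) ∧
        (∃ τ : ℝ, 0 < τ ∧ ∀ t ∈ Set.Icc (0:ℝ) 1,
          Set.EqOn (H t) h₀ (Set.Icc 0 τ ∪ Set.Icc (1 - τ) 1))) ↔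
      σ₀ 1 - σ₀ 0 = σ₁ 1 - σ₁ 0) := by
  have mem0 : (0 : ℝ) ∈ Icc (0 : ℝ) 1 := left_mem_Icc.2 zero_le_one
  have mem1 : (1 : ℝ) ∈ Icc (0 : ℝ) 1 := right_mem_Icc.2 zero_le_one
  have hd₀ : Differentiable ℝ h₀ := h₀_sm.differentiable (by simp)
  have hd₁ : Differentiable ℝ h₁ := h₁_sm.differentiable (by simp)
  have hc₀ : Continuous (deriv h₀) := h₀_sm.continuous_deriv (by simp)
  have hc₁ : Continuous (deriv h₁) := h₁_sm.continuous_deriv (by simp)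
  have h₀'_sm : ContDiff ℝ ∞ (deriv h₀) := (contDiff_infty_iff_deriv.1 h₀_sm).2
  have h₁'_sm : ContDiff ℝ ∞ (deriv h₁) := (contDiff_infty_iff_deriv.1 h₁_sm).2
  obtain ⟨τ, hτ, hτ1, hh⟩ : ∃ τ : ℝ, 0 < τ ∧ τ ≤ 1 ∧ EqOn h₀ h₁ (Icc 0 τ ∪ Icc (1 - τ) 1) := by
    obtain ⟨τ, hτ, h⟩ := heq
    refine ⟨min τ 1, by positivity, min_le_right _ _, h.mono (union_subset_union
      (Icc_subset_Icc_right (min_le_left _ _)) (Icc_subset_Icc_left ?_))⟩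
    linarith [min_le_left τ 1]
  have hdl : EqOn (deriv h₀) (deriv h₁) (Icc 0 τ) :=
    deriv_eqOn_Icc hτ hd₀ hd₁ (hh.mono subset_union_left)
  have hdr : EqOn (deriv h₀) (deriv h₁) (Icc (1 - τ) 1) :=
    deriv_eqOn_Icc (by linarith) hd₀ hd₁ (hh.mono subset_union_right)
  have e0 : deriv h₀ 0 = deriv h₁ 0 := hdl ⟨le_rfl, hτ.le⟩
  have e1 : deriv h₀ 1 = deriv h₁ 1 := hdr ⟨by linarith, le_rfl⟩
  obtain ⟨F₀, F₀_sm, hF₀0, hF₀⟩ := exists_contDiff_log h₀'_sm himm0 (exp_log (himm0 0 mem0))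
  obtain ⟨F₁, F₁_sm, hF₁0, hF₁⟩ := exists_contDiff_log h₁'_sm himm1
    ((exp_log (himm0 0 mem0)).trans e0)
  have w₀ := log_sub_eq_of_lift hc₀.continuousOn himm0 hσ₀c hlift0 F₀_sm.continuous.continuousOn hF₀
  have w₁ := log_sub_eq_of_lift hc₁.continuousOn himm1 hσ₁c hlift1 F₁_sm.continuous.continuousOn hF₁
  rw [hF₀0] at w₀
  rw [hF₁0, ← e0, ← e1] at w₁
  refine ⟨?_, ?_, ?_⟩
  · have : exp (F₀ 1) = exp (F₁ 1) := by rw [hF₀ 1 mem1, hF₁ 1 mem1, e1]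
    obtain ⟨m, hm⟩ := exp_eq_exp_iff_exists_int.1 this
    refine ⟨m, ?_⟩
    have h : I * (((σ₀ 1 - σ₀ 0) - (σ₁ 1 - σ₁ 0) : ℝ) : ℂ) = I * ((2 * Real.pi * m : ℝ) : ℂ) := by
      push_cast at w₀ w₁ ⊢
      linear_combination hm - w₀ + w₁
    exact_mod_cast mul_left_cancel₀ I_ne_zero h
  · rintro ⟨H, hH, hH0, hH1, himm, τ', hτ', hHτ⟩
    have hHd : ∀ t, Differentiable ℝ (H t) := fun t =>
      (hH.comp (contDiff_const.prodMk contDiff_id)).differentiable (by simp)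
    have hu : Continuous (Function.uncurry fun t r => deriv (H t) r) := by
      have h1 : Continuous fun x : ℝ × ℝ => fderiv ℝ (Function.uncurry H) x (0, 1) :=
        (hH.continuous_fderiv (by simp)).clm_apply continuous_const
      convert h1 using 1
      funext ⟨t, r⟩
      exact ((hH.differentiable (by simp) (t, r)).hasFDerivAt.comp_hasDerivAt r
        ((hasDerivAt_const r t).prodMk (hasDerivAt_id r))).deriv
    obtain ⟨L, hL, hLu⟩ := exists_continuous_log_square hu himm
    have hLr : ∀ t, ContinuousOn (L t) (Icc 0 1) := fun t =>
      (hL.comp (continuous_const.prodMk continuous_id)).continuousOn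
    have hLt : ∀ r, ContinuousOn (fun t => L t r) (Icc 0 1) := fun r =>
      (hL.comp (continuous_id.prodMk continuous_const)).continuousOn
    have hconst : ∀ r ∈ Icc (0 : ℝ) 1, (∀ t ∈ Icc (0 : ℝ) 1, deriv (H t) r = deriv h₀ r) →
        L 1 r = L 0 r := fun r hr h => by
      have := sub_eq_sub_of_exp_eqOn (hLt r) (continuousOn_const (c := L 0 r)) (fun t ht => by
        rw [hLu t ht r hr, hLu 0 mem0 r hr, h t ht, h 0 mem0]) mem1 mem0
      simpa [sub_eq_zero] using this
    have c0 := hconst 0 mem0 fun t ht =>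
      deriv_eqOn_Icc hτ' (hHd t) hd₀ ((hHτ t ht).mono subset_union_left) ⟨le_rfl, hτ'.le⟩
    have c1 := hconst 1 mem1 fun t ht =>
      deriv_eqOn_Icc (by linarith) (hHd t) hd₀ ((hHτ t ht).mono subset_union_right)
        ⟨by linarith, le_rfl⟩
    have v₀ := log_sub_eq_of_lift hc₀.continuousOn himm0 hσ₀c hlift0 (hLr 0) fun r hr => by
      rw [hLu 0 mem0 r hr, deriv_eqOn_Icc one_pos (hHd 0) hd₀ hH0 hr]
    have v₁ := log_sub_eq_of_lift hc₁.continuousOn himm1 hσ₁c hlift1 (hLr 1) fun r hr => by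
      rw [hLu 1 mem1 r hr, deriv_eqOn_Icc one_pos (hHd 1) hd₁ hH1 hr]
    rw [← e0, ← e1, c0, c1, v₀] at v₁
    exact_mod_cast mul_left_cancel₀ I_ne_zero (add_left_cancel v₁)
  · intro hw
    have hF1 : F₀ 1 = F₁ 1 := by
      rw [hw] at w₀
      exact sub_left_injective (w₀.trans w₁.symm)
    refine exists_regular_homotopy hτ hτ1 h₀_sm h₁_sm F₀_sm F₁_sm hF₀ hF₁ hh ?_
    rintro r (hr | hr)
    · have := sub_eq_sub_of_exp_eqOn F₀_sm.continuous.continuousOn F₁_sm.continuous.continuousOn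
        (fun x hx => by
          have hx' : x ∈ Icc (0 : ℝ) 1 := ⟨hx.1, hx.2.trans hτ1⟩
          rw [hF₀ x hx', hF₁ x hx', hdl hx]) hr (left_mem_Icc.2 hτ.le)
      rwa [hF₀0, hF₁0, sub_self, sub_eq_zero] at this
    · have := sub_eq_sub_of_exp_eqOn F₀_sm.continuous.continuousOn F₁_sm.continuous.continuousOn
        (fun x hx => by
          have hx' : x ∈ Icc (0 : ℝ) 1 := ⟨by linarith [hx.1], hx.2⟩
          rw [hF₀ x hx', hF₁ x hx', hdr hx]) hr (right_mem_Icc.2 (by linarith))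
      rwa [hF1, sub_self, sub_eq_zero] at this
end

section
/- For j = 0,1 let h_j, g_j : ℝ → ℂ be smooth maps such that h_j' is nowhere zero and 1-periodic, g_j is 1-periodic, ⟨g_j'(r), i·h_j'(r)⟩ = 0 and ⟨g_j(r), i·h_j'(r)⟩ > 0 for all r ∈ ℝ, and assume h₀(1) − h₀(0) = h₁(1) − h₁(0). Then the following are equivalent: (a) there exist smooth families h_t, g_t : ℝ → ℂ, t ∈ [0,1], connecting (h₀,g₀) to (h₁,g₁), such that for every t the map h_t' is nowhere zero and 1-periodic, g_t is 1-periodic, ⟨g_t'(r), i·h_t'(r)⟩ = 0 and ⟨g_t(r), i·h_t'(r)⟩ > 0 for all r, and h_t(1) − h_t(0) is independent of t; (b) the 1-periodic maps h₀'/|h₀'| and h₁'/|h₁'| have the same degree, i.e. continuous lifts σ_j : ℝ → ℝ with h_j'(r) = |h_j'(r)|·e^{iσ_j(r)} satisfy σ₀(1) − σ₀(0) = σ₁(1) − σ₁(0). -/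
namespace StableHomotopy

open Set Filter Topology Complex
open scoped ContDiff

/-- The conditions on a pair `(h, g)` to encode a stable Hamiltonian structure of class `c`. -/
def IsStable (c : ℂ) (h g : ℝ → ℂ) : Prop :=
  (∀ r : ℝ, deriv h r ≠ 0) ∧
  (∀ r : ℝ, deriv h (r + 1) = deriv h r) ∧
  (∀ r : ℝ, g (r + 1) = g r) ∧
  (∀ r : ℝ, rinner (deriv g r) (Complex.I * deriv h r) = 0 ∧
    0 < rinner (g r) (Complex.I * deriv h r)) ∧
  h 1 - h 0 = c

/-- Two pairs of maps are joined by a smooth homotopy through pairs satisfying `P`. -/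
def SmoothConn (P : (ℝ → ℂ) → (ℝ → ℂ) → Prop) (h g k l : ℝ → ℂ) : Prop :=
  ∃ H G : ℝ → ℝ → ℂ,
    ContDiff ℝ (⊤ : ℕ∞) (Function.uncurry H) ∧
    ContDiff ℝ (⊤ : ℕ∞) (Function.uncurry G) ∧
    (∀ r : ℝ, H 0 r = h r ∧ G 0 r = g r ∧ H 1 r = k r ∧ G 1 r = l r) ∧
    (∀ t ∈ Set.Icc (0 : ℝ) 1, P (H t) (G t))

theorem SmoothConn.symm {P : (ℝ → ℂ) → (ℝ → ℂ) → Prop} {h g k l : ℝ → ℂ}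
    (hc : SmoothConn P h g k l) : SmoothConn P k l h g := by
  obtain ⟨H, G, hH, hG, he, hP⟩ := hc
  have hrev : ContDiff ℝ (⊤ : ℕ∞) (fun p : ℝ × ℝ => (1 - p.1, p.2)) := by fun_prop
  refine ⟨fun t r => H (1 - t) r, fun t r => G (1 - t) r, hH.comp hrev, hG.comp hrev, ?_, ?_⟩
  · intro r
    obtain ⟨h1, h2, h3, h4⟩ := he r
    simp [h1, h2, h3, h4]
  · intro t ht
    exact hP (1 - t) ⟨by linarith [ht.2], by linarith [ht.1]⟩

/-- The smooth concatenation of two families of maps whose ends match. -/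
noncomputable def glue (F K : ℝ → ℝ → ℂ) (t r : ℝ) : ℂ :=
  F (Real.smoothTransition (2 * t)) r + K (Real.smoothTransition (2 * t - 1)) r - K 0 r

theorem contDiff_glue {F K : ℝ → ℝ → ℂ} (hF : ContDiff ℝ (⊤ : ℕ∞) (Function.uncurry F))
    (hK : ContDiff ℝ (⊤ : ℕ∞) (Function.uncurry K)) :
    ContDiff ℝ (⊤ : ℕ∞) (Function.uncurry (glue F K)) := by
  have hst : ContDiff ℝ (⊤ : ℕ∞) Real.smoothTransition := Real.smoothTransition.contDiff
  have h1 : ContDiff ℝ (⊤ : ℕ∞)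
      (fun p : ℝ × ℝ => (Real.smoothTransition (2 * p.1), p.2)) := by fun_prop
  have h2 : ContDiff ℝ (⊤ : ℕ∞)
      (fun p : ℝ × ℝ => (Real.smoothTransition (2 * p.1 - 1), p.2)) := by fun_prop
  have h3 : ContDiff ℝ (⊤ : ℕ∞) (fun p : ℝ × ℝ => ((0 : ℝ), p.2)) := by fun_prop
  exact ((hF.comp h1).add (hK.comp h2)).sub (hK.comp h3)

theorem glue_of_le {F K : ℝ → ℝ → ℂ} {t : ℝ} (ht : t ≤ 1 / 2) :
    glue F K t = F (Real.smoothTransition (2 * t)) := by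
  funext r
  have h0 : Real.smoothTransition (2 * t - 1) = 0 :=
    Real.smoothTransition.zero_of_nonpos (by linarith)
  simp [glue, h0]

theorem glue_of_ge {F K : ℝ → ℝ → ℂ} (hm : ∀ r, F 1 r = K 0 r) {t : ℝ} (ht : 1 / 2 ≤ t) :
    glue F K t = K (Real.smoothTransition (2 * t - 1)) := by
  funext r
  have h1 : Real.smoothTransition (2 * t) = 1 :=
    Real.smoothTransition.one_of_one_le (by linarith)
  simp [glue, h1, hm]

theorem SmoothConn.trans {P : (ℝ → ℂ) → (ℝ → ℂ) → Prop} {h g k l m n : ℝ → ℂ}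
    (h₁ : SmoothConn P h g k l) (h₂ : SmoothConn P k l m n) : SmoothConn P h g m n := by
  obtain ⟨H, G, hH, hG, he, hP⟩ := h₁
  obtain ⟨K, L, hK, hL, he', hP'⟩ := h₂
  have hm : ∀ r, H 1 r = K 0 r := fun r => (he r).2.2.1.trans (he' r).1.symm
  have hm' : ∀ r, G 1 r = L 0 r := fun r => (he r).2.2.2.trans (he' r).2.1.symm
  refine ⟨glue H K, glue G L, contDiff_glue hH hK, contDiff_glue hG hL, ?_, ?_⟩
  · intro r
    have e0 : (0 : ℝ) ≤ 1 / 2 := by norm_num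
    have e1 : (1 : ℝ) / 2 ≤ 1 := by norm_num
    rw [glue_of_le e0, glue_of_le e0, glue_of_ge hm e1, glue_of_ge hm' e1]
    norm_num [Real.smoothTransition.zero, Real.smoothTransition.one]
    exact ⟨(he r).1, (he r).2.1, (he' r).2.2.1, (he' r).2.2.2⟩
  · intro t _
    rcases le_total t (1 / 2) with ht | ht
    · rw [glue_of_le ht, glue_of_le ht]
      exact hP _ ⟨Real.smoothTransition.nonneg _, Real.smoothTransition.le_one _⟩
    · rw [glue_of_ge hm ht, glue_of_ge hm' ht]
      exact hP' _ ⟨Real.smoothTransition.nonneg _, Real.smoothTransition.le_one _⟩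

theorem rinner_eq_inner (z w : ℂ) : rinner z w = inner ℝ w z := by
  simp [rinner, Complex.inner]

/-- For fixed `h`, the stabilizing maps `g` form a convex set. -/
theorem smoothConn_of_same_left {c : ℂ} {h g l : ℝ → ℂ} (hh : ContDiff ℝ (⊤ : ℕ∞) h)
    (hg : ContDiff ℝ (⊤ : ℕ∞) g) (hl : ContDiff ℝ (⊤ : ℕ∞) l)
    (hs : IsStable c h g) (hs' : IsStable c h l) : SmoothConn (IsStable c) h g h l := by
  obtain ⟨h1, h2, h3, h4, h5⟩ := hs
  obtain ⟨-, -, h3', h4', -⟩ := hs'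
  refine ⟨fun _ r => h r, fun t r => (1 - t : ℝ) • g r + t • l r, ?_, ?_, ?_, ?_⟩
  · exact hh.comp contDiff_snd
  · have e1 : ContDiff ℝ (⊤ : ℕ∞) (fun p : ℝ × ℝ => (1 - p.1 : ℝ)) := by fun_prop
    exact (e1.smul (hg.comp contDiff_snd)).add (contDiff_fst.smul (hl.comp contDiff_snd))
  · intro r; simp
  · intro t ht
    refine ⟨h1, h2, fun r => by simp [h3, h3'], fun r => ?_, h5⟩
    have hd : deriv (fun r => (1 - t : ℝ) • g r + t • l r) r
        = (1 - t : ℝ) • deriv g r + t • deriv l r :=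
      (((hg.differentiable (by simp) r).hasDerivAt.const_smul (1 - t)).add
        ((hl.differentiable (by simp) r).hasDerivAt.const_smul t)).deriv
    obtain ⟨a1, a2⟩ := h4 r
    obtain ⟨b1, b2⟩ := h4' r
    rw [rinner_eq_inner] at a1 a2 b1 b2
    rw [hd, rinner_eq_inner, rinner_eq_inner, inner_add_right, inner_add_right,
      real_inner_smul_right, real_inner_smul_right, real_inner_smul_right, real_inner_smul_right,
      a1, b1]
    refine ⟨by ring, ?_⟩
    rcases eq_or_lt_of_le ht.1 with h0 | h0
    · rw [← h0]; simpa using a2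
    · have := mul_nonneg (sub_nonneg.2 ht.2) a2.le
      have := mul_pos h0 b2
      linarith

/-- The unit normal field along a curve with velocity `v`. -/
noncomputable def unitNormal (v : ℝ → ℂ) (r : ℝ) : ℂ := (‖v r‖⁻¹ : ℝ) • (I * v r)

theorem isStable_unitNormal {c : ℂ} {h v : ℝ → ℂ} (hh : ∀ r, HasDerivAt h (v r) r)
    (hv : Differentiable ℝ v) (hne : ∀ r, v r ≠ 0) (hper : ∀ r, v (r + 1) = v r)
    (hc : h 1 - h 0 = c) : IsStable c h (unitNormal v) := by
  have hd : deriv h = v := funext fun r => (hh r).deriv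
  refine ⟨by rwa [hd], by rwa [hd], fun r => by simp [unitNormal, hper], fun r => ?_, hc⟩
  rw [hd]
  have hpos : 0 < ‖v r‖ := norm_pos_iff.2 (hne r)
  have hI : I * v r = ‖v r‖ • unitNormal v r := by
    rw [unitNormal, smul_smul, mul_inv_cancel₀ hpos.ne', one_smul]
  have hnorm : ∀ s, inner ℝ (unitNormal v s) (unitNormal v s) = 1 := by
    intro s
    have hs : ‖v s‖ ≠ 0 := norm_ne_zero_iff.2 (hne s)
    rw [real_inner_self_eq_norm_sq, unitNormal, norm_smul]
    simp [hs]
  have hdiff : DifferentiableAt ℝ (unitNormal v) r := by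
    have e : DifferentiableAt ℝ (fun s => ‖v s‖⁻¹) r :=
      ((hv r).norm ℝ (hne r)).inv hpos.ne'
    exact e.smul ((hv r).const_mul I)
  have hder := hdiff.hasDerivAt.inner ℝ hdiff.hasDerivAt
  have hder0 : HasDerivAt (fun s => inner ℝ (unitNormal v s) (unitNormal v s)) 0 r := by
    simp_rw [hnorm]; exact hasDerivAt_const r _
  have h0 := hder.unique hder0
  rw [real_inner_comm] at h0
  rw [rinner_eq_inner, rinner_eq_inner, hI, real_inner_smul_left, real_inner_smul_left, hnorm]
  constructor
  · rw [mul_eq_zero]; right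
    rw [real_inner_comm] at h0
    have h1 := real_inner_comm (unitNormal v r) (deriv (unitNormal v) r)
    linarith
  · simpa using hpos

theorem contDiff_unitNormal {v : ℝ → ℂ} (hv : ContDiff ℝ (⊤ : ℕ∞) v) (hne : ∀ r, v r ≠ 0) :
    ContDiff ℝ (⊤ : ℕ∞) (unitNormal v) :=
  ((hv.norm ℝ hne).inv fun r => norm_ne_zero_iff.2 (hne r)).smul (contDiff_const.mul hv)

/-- Curves whose velocities are joined by a nonvanishing segment are connected, when equipped with
their unit normal fields. -/
theorem smoothConn_segment {c : ℂ} {h k v w : ℝ → ℂ}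
    (hh : ContDiff ℝ (⊤ : ℕ∞) h) (hk : ContDiff ℝ (⊤ : ℕ∞) k)
    (hhv : ∀ r, HasDerivAt h (v r) r) (hkw : ∀ r, HasDerivAt k (w r) r)
    (hv : ContDiff ℝ (⊤ : ℕ∞) v) (hw : ContDiff ℝ (⊤ : ℕ∞) w)
    (hvp : ∀ r, v (r + 1) = v r) (hwp : ∀ r, w (r + 1) = w r)
    (hhc : h 1 - h 0 = c) (hkc : k 1 - k 0 = c)
    (hne : ∀ s ∈ Icc (0 : ℝ) 1, ∀ r, (1 - s) • v r + s • w r ≠ 0) :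
    SmoothConn (IsStable c) h (unitNormal v) k (unitNormal w) := by
  set τ := Real.smoothTransition
  have hτ : ContDiff ℝ (⊤ : ℕ∞) (fun p : ℝ × ℝ => τ p.1) :=
    Real.smoothTransition.contDiff.comp contDiff_fst
  have hτ' : ContDiff ℝ (⊤ : ℕ∞) (fun p : ℝ × ℝ => 1 - τ p.1) := contDiff_const.sub hτ
  have hmem : ∀ t, τ t ∈ Icc (0 : ℝ) 1 := fun t =>
    ⟨Real.smoothTransition.nonneg _, Real.smoothTransition.le_one _⟩
  have hW : ContDiff ℝ (⊤ : ℕ∞) (fun p : ℝ × ℝ => (1 - τ p.1) • v p.2 + τ p.1 • w p.2) :=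
    (hτ'.smul (hv.comp contDiff_snd)).add (hτ.smul (hw.comp contDiff_snd))
  have hWne : ∀ p : ℝ × ℝ, (1 - τ p.1) • v p.2 + τ p.1 • w p.2 ≠ 0 := fun p =>
    hne _ (hmem p.1) p.2
  have τ0 : τ 0 = 0 := Real.smoothTransition.zero
  have τ1 : τ 1 = 1 := Real.smoothTransition.one
  refine ⟨fun t r => (1 - τ t) • h r + τ t • k r,
    fun t => unitNormal fun r => (1 - τ t) • v r + τ t • w r, ?_, ?_, ?_, ?_⟩
  · exact (hτ'.smul (hh.comp contDiff_snd)).add (hτ.smul (hk.comp contDiff_snd))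
  · exact ((hW.norm ℝ hWne).inv fun p => norm_ne_zero_iff.2 (hWne p)).smul (contDiff_const.mul hW)
  · intro r; simp [τ0, τ1]
  · intro t _
    apply isStable_unitNormal
    · intro r
      exact ((hhv r).const_smul (1 - τ t)).add ((hkw r).const_smul (τ t))
    · have e1 := (hv.differentiable (by simp)).const_smul (1 - τ t)
      have e2 := (hw.differentiable (by simp)).const_smul (τ t)
      exact e1.add e2
    · exact hne _ (hmem t)
    · intro r; simp only [hvp, hwp]
    · have : (1 - τ t) • h 1 + τ t • k 1 - ((1 - τ t) • h 0 + τ t • k 0)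
          = (1 - τ t) • (h 1 - h 0) + τ t • (k 1 - k 0) := by
        simp only [smul_sub]; ring
      rw [this, hhc, hkc, ← add_smul]; simp

/-- A smooth nowhere vanishing periodic velocity field with mean `c`. -/
structure IsVelocity (c : ℂ) (v : ℝ → ℂ) : Prop where
  smooth : ContDiff ℝ (⊤ : ℕ∞) v
  ne_zero : ∀ r, v r ≠ 0
  periodic : ∀ r, v (r + 1) = v r
  mean : ∫ x in (0 : ℝ)..1, v x = c

/-- The curve starting at the origin with velocity `v`. -/
noncomputable def primitive (v : ℝ → ℂ) (r : ℝ) : ℂ := ∫ x in (0 : ℝ)..r, v x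

theorem hasDerivAt_primitive {v : ℝ → ℂ} (hv : Continuous v) (r : ℝ) :
    HasDerivAt (primitive v) (v r) r :=
  hv.integral_hasStrictDerivAt 0 r |>.hasDerivAt

theorem contDiff_of_hasDerivAt {h v : ℝ → ℂ} (hh : ∀ r, HasDerivAt h (v r) r)
    (hv : ContDiff ℝ (⊤ : ℕ∞) v) : ContDiff ℝ (⊤ : ℕ∞) h := by
  have hd : deriv h = v := funext fun r => (hh r).deriv
  exact contDiff_infty_iff_deriv.2 ⟨fun r => (hh r).differentiableAt, by rwa [hd]⟩

/-- Two velocity fields are joined by a homotopy of the curves equipped with unit normals. -/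
def VelConn (c : ℂ) (v w : ℝ → ℂ) : Prop :=
  SmoothConn (IsStable c) (primitive v) (unitNormal v) (primitive w) (unitNormal w)

theorem VelConn.of_segment {c : ℂ} {v w : ℝ → ℂ} (hv : ContDiff ℝ (⊤ : ℕ∞) v)
    (hw : ContDiff ℝ (⊤ : ℕ∞) w) (hvp : ∀ r, v (r + 1) = v r) (hwp : ∀ r, w (r + 1) = w r)
    (hvc : ∫ x in (0 : ℝ)..1, v x = c) (hwc : ∫ x in (0 : ℝ)..1, w x = c)
    (hne : ∀ s ∈ Icc (0 : ℝ) 1, ∀ r, (1 - s) • v r + s • w r ≠ 0) : VelConn c v w :=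
  smoothConn_segment
    (contDiff_of_hasDerivAt (hasDerivAt_primitive hv.continuous) hv)
    (contDiff_of_hasDerivAt (hasDerivAt_primitive hw.continuous) hw)
    (hasDerivAt_primitive hv.continuous) (hasDerivAt_primitive hw.continuous)
    hv hw hvp hwp (by simpa [primitive] using hvc) (by simpa [primitive] using hwc) hne

theorem isVelocity_deriv {c : ℂ} {h g : ℝ → ℂ} (hh : ContDiff ℝ (⊤ : ℕ∞) h)
    (hs : IsStable c h g) : IsVelocity c (deriv h) := by
  have hsm := (contDiff_infty_iff_deriv.1 hh).2
  refine ⟨hsm, hs.1, hs.2.1, ?_⟩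
  rw [intervalIntegral.integral_deriv_eq_sub (fun x _ => hh.differentiable (by simp) x)
    (hsm.continuous.intervalIntegrable _ _)]
  exact hs.2.2.2.2

/-- Every stable pair is connected to the normalized pair with the same velocity. -/
theorem IsStable.smoothConn_primitive {c : ℂ} {h g : ℝ → ℂ} (hh : ContDiff ℝ (⊤ : ℕ∞) h)
    (hg : ContDiff ℝ (⊤ : ℕ∞) g) (hs : IsStable c h g) :
    SmoothConn (IsStable c) h g (primitive (deriv h)) (unitNormal (deriv h)) := by
  have hv := isVelocity_deriv hh hs
  have hd : ∀ r, HasDerivAt h (deriv h r) r := fun r =>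
    (hh.differentiable (by simp) r).hasDerivAt
  have hp := hasDerivAt_primitive hv.smooth.continuous
  refine (smoothConn_of_same_left hh hg (contDiff_unitNormal hv.smooth hv.ne_zero) hs
    (isStable_unitNormal hd (hv.smooth.differentiable (by simp)) hv.ne_zero hv.periodic
      hs.2.2.2.2)).trans
    (smoothConn_segment hh (contDiff_of_hasDerivAt hp hv.smooth) hd hp hv.smooth hv.smooth
      hv.periodic hv.periodic hs.2.2.2.2 (by simpa [primitive] using hv.mean) ?_)
  intro s _ r
  rw [← add_smul, sub_add_cancel, one_smul]
  exact hv.ne_zero r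


theorem eq_of_exp_I_mul_eq {f : ℝ → ℝ} (hf : Continuous f)
    (h : ∀ x, exp (I * f x) = exp (I * f 0)) (x : ℝ) : f x = f 0 := by
  have hn : ∀ x, ∃ n : ℤ, (f x - f 0) / (2 * Real.pi) = n := by
    intro x
    obtain ⟨n, hn⟩ := exp_eq_exp_iff_exists_int.1 (h x)
    refine ⟨n, ?_⟩
    have h1 : (f x : ℂ) = f 0 + n * (2 * Real.pi) := by
      apply mul_left_cancel₀ I_ne_zero
      rw [hn]; ring
    have h2 : f x = f 0 + n * (2 * Real.pi) := by exact_mod_cast h1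
    rw [h2]
    field_simp
    ring
  choose n hn using hn
  have hcont : Continuous n := by
    rw [Int.isClosedEmbedding_coe_real.isInducing.continuous_iff]
    have : ((fun k : ℤ => (k : ℝ)) ∘ n) = fun x => (f x - f 0) / (2 * Real.pi) :=
      funext fun x => (hn x).symm
    rw [this]
    fun_prop
  have hx : n x = n 0 := PreconnectedSpace.constant inferInstance hcont
  have := hn x
  rw [hx, ← hn 0] at this
  field_simp at this
  linarith

theorem sub_eq_of_exp_I_mul_eq {σ τ : ℝ → ℝ} (hσ : Continuous σ) (hτ : Continuous τ)
    (h : ∀ x, exp (I * σ x) = exp (I * τ x)) (x : ℝ) : σ x - τ x = σ 0 - τ 0 := by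
  refine eq_of_exp_I_mul_eq (hσ.sub hτ) (fun y => ?_) x
  have : ∀ y, exp (I * (σ y - τ y : ℝ)) = 1 := by
    intro y
    rw [ofReal_sub, mul_sub, exp_sub, h, div_self (exp_ne_zero _)]
  exact (this y).trans (this 0).symm

theorem norm_exp_I_mul (x : ℝ) : ‖exp (I * x)‖ = 1 := by
  rw [mul_comm]; exact norm_exp_ofReal_mul_I x

theorem norm_exp_I_mul_sub_le (x y : ℝ) : ‖exp (I * x) - exp (I * y)‖ ≤ |x - y| := by
  have h : exp (I * x) - exp (I * y) = exp (I * y) * (exp (I * (x - y : ℝ)) - 1) := by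
    rw [mul_sub, ← exp_add, mul_one]
    congr 2
    push_cast; ring
  rw [h, norm_mul, norm_exp_I_mul, one_mul]
  exact Real.norm_exp_I_mul_ofReal_sub_one_le

/-- A smooth angle function with increment `d` over a period. -/
structure IsAngle (d : ℝ) (σ : ℝ → ℝ) : Prop where
  smooth : ContDiff ℝ (⊤ : ℕ∞) σ
  shift : ∀ r, σ (r + 1) = σ r + d

/-- The unit vector field with angle `σ`. -/
noncomputable def dir (σ : ℝ → ℝ) (r : ℝ) : ℂ := exp (I * σ r)

/-- The mean over a period of the unit vector field with angle `σ`. -/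
noncomputable def meanDir (σ : ℝ → ℝ) : ℂ := ∫ x in (0 : ℝ)..1, dir σ x

theorem continuous_dir {σ : ℝ → ℝ} (hσ : Continuous σ) : Continuous (dir σ) := by
  unfold dir; fun_prop

theorem IsAngle.contDiff_dir {d : ℝ} {σ : ℝ → ℝ} (hσ : IsAngle d σ) :
    ContDiff ℝ (⊤ : ℕ∞) (dir σ) :=
  (contDiff_const.mul (ofRealCLM.contDiff.comp hσ.smooth)).cexp

theorem IsAngle.dir_add_one {d : ℝ} (hd : exp (I * d) = 1) {σ : ℝ → ℝ} (hσ : IsAngle d σ)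
    (r : ℝ) : dir σ (r + 1) = dir σ r := by
  rw [dir, hσ.shift, ofReal_add, mul_add, exp_add, hd, mul_one, dir]

theorem IsAngle.norm_meanDir_lt_one {d : ℝ} (hd : exp (I * d) = 1) {σ : ℝ → ℝ}
    (hσ : IsAngle d σ) (hne : ∃ x y, σ x ≠ σ y) : ‖meanDir σ‖ < 1 := by
  by_contra! hle
  have hcont := continuous_dir hσ.smooth.continuous
  have hm : meanDir σ ≠ 0 := norm_pos_iff.1 (by linarith)
  set u : ℂ := (starRingEnd ℂ) (meanDir σ) / ‖meanDir σ‖ with hu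
  have hun : ‖u‖ = 1 := by
    rw [hu, norm_div, RCLike.norm_conj, norm_real, norm_norm, div_self (norm_ne_zero_iff.2 hm)]
  have hum : u * meanDir σ = ‖meanDir σ‖ := by
    have hn : (‖meanDir σ‖ : ℂ) ≠ 0 := by exact_mod_cast norm_ne_zero_iff.2 hm
    rw [hu, div_mul_eq_mul_div, mul_comm, Complex.mul_conj, Complex.normSq_eq_norm_sq]
    push_cast
    field_simp
  have hint : ∫ x in (0 : ℝ)..1, (u * dir σ x).re = ‖meanDir σ‖ := by
    have h1 := reCLM.intervalIntegral_comp_comm (μ := MeasureTheory.volume) (a := 0) (b := 1)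
      (f := fun x => u * dir σ x) ((continuous_const.mul hcont).intervalIntegrable _ _)
    simp only [reCLM_apply] at h1
    rw [h1, intervalIntegral.integral_const_mul, ← meanDir, hum, ofReal_re]
  have hbound : ∀ x, ‖u * dir σ x‖ = 1 := fun x => by
    rw [norm_mul, hun, dir, norm_exp_I_mul, one_mul]
  have hre : ∀ x, (u * dir σ x).re ≤ 1 := fun x => (re_le_norm _).trans (hbound x).le
  have hrec : Continuous fun x => (u * dir σ x).re := continuous_re.comp (continuous_const.mul hcont)
  have hre1 : ∀ x ∈ Icc (0 : ℝ) 1, (u * dir σ x).re = 1 := by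
    by_contra! hlt
    obtain ⟨x, hx, hx1⟩ := hlt
    have := intervalIntegral.integral_lt_integral_of_continuousOn_of_le_of_exists_lt
      (f := fun x => (u * dir σ x).re) (g := fun _ => (1 : ℝ)) zero_lt_one
      hrec.continuousOn continuousOn_const (fun x _ => hre x)
      ⟨x, hx, lt_of_le_of_ne (hre x) hx1⟩
    rw [hint] at this
    simp at this
    linarith
  have hper : Function.Periodic (dir σ) 1 := hσ.dir_add_one hd
  have hdir : ∀ x, u * dir σ x = 1 := by
    intro x
    obtain ⟨y, hy, hxy⟩ := hper.exists_mem_Ico₀ one_pos x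
    rw [hxy]
    have h1 := hre1 y ⟨hy.1, hy.2.le⟩
    have h2 := hbound y
    have h3 : (u * dir σ y).im = 0 := by
      have h4 := Complex.sq_norm (u * dir σ y)
      rw [h2, Complex.normSq_apply, h1] at h4
      nlinarith
    exact Complex.ext (by simpa using h1) (by simpa using h3)
  have hu0 : u ≠ 0 := norm_pos_iff.1 (by rw [hun]; exact one_pos)
  have hconst := eq_of_exp_I_mul_eq hσ.smooth.continuous fun x =>
    mul_left_cancel₀ hu0 ((hdir x).trans (hdir 0).symm)
  obtain ⟨x, y, hxy⟩ := hne
  exact hxy ((hconst x).trans (hconst y).symm)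

theorem norm_meanDir_sub_le {σ τ : ℝ → ℝ} (hσ : Continuous σ) (hτ : Continuous τ) {δ : ℝ}
    (h : ∀ r, |σ r - τ r| ≤ δ) : ‖meanDir σ - meanDir τ‖ ≤ δ := by
  rw [meanDir, meanDir, ← intervalIntegral.integral_sub
    ((continuous_dir hσ).intervalIntegrable _ _) ((continuous_dir hτ).intervalIntegrable _ _)]
  have := intervalIntegral.norm_integral_le_of_norm_le_const (a := 0) (b := 1) (C := δ)
    (f := fun x => dir σ x - dir τ x) fun x _ => (norm_exp_I_mul_sub_le _ _).trans (h x)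
  simpa using this

/-- The unit vector field with angle `σ` dilated by `L` and translated to have mean `c`. -/
noncomputable def dilation (c : ℂ) (σ : ℝ → ℝ) (L r : ℝ) : ℂ :=
  L • dir σ r + (c - L • meanDir σ)

theorem IsAngle.contDiff_dilation {d : ℝ} {σ : ℝ → ℝ} (hσ : IsAngle d σ) (c : ℂ) (L : ℝ) :
    ContDiff ℝ (⊤ : ℕ∞) (dilation c σ L) :=
  ((contDiff_const (c := L)).smul hσ.contDiff_dir).add
    (contDiff_const (c := c - L • meanDir σ))

theorem IsAngle.dilation_add_one {d : ℝ} (hd : exp (I * d) = 1) {σ : ℝ → ℝ} (hσ : IsAngle d σ)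
    (c : ℂ) (L r : ℝ) : dilation c σ L (r + 1) = dilation c σ L r := by
  rw [dilation, hσ.dir_add_one hd, dilation]

theorem integral_dilation {σ : ℝ → ℝ} (hσ : Continuous σ) (c : ℂ) (L : ℝ) :
    ∫ x in (0 : ℝ)..1, dilation c σ L x = c := by
  unfold dilation
  rw [intervalIntegral.integral_add
    (f := fun x => L • dir σ x) (((continuous_dir hσ).const_smul L).intervalIntegrable _ _)
    (by simp),
    intervalIntegral.integral_smul, intervalIntegral.integral_const]
  simp [meanDir]

theorem eventually_norm_lt_mul (c : ℂ) {a : ℝ} (ha : 0 < a) :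
    ∀ᶠ L : ℝ in atTop, 0 < L ∧ ‖c‖ < L * a :=
  (eventually_gt_atTop 0).and ((tendsto_id.atTop_mul_const ha).eventually_gt_atTop ‖c‖)

theorem velConn_dilation_of_close {d : ℝ} (hd : exp (I * d) = 1) {σ τ : ℝ → ℝ}
    (hσ : IsAngle d σ) (hτ : IsAngle d τ) (c : ℂ) {δ : ℝ} (h : ∀ r, |σ r - τ r| ≤ δ)
    (hδ : ‖meanDir σ‖ + 2 * δ < 1) :
    ∀ᶠ L in atTop, VelConn c (dilation c σ L) (dilation c τ L) := by
  filter_upwards [eventually_norm_lt_mul c (a := 1 - (‖meanDir σ‖ + 2 * δ)) (by linarith)]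
    with L hL
  refine VelConn.of_segment (hσ.contDiff_dilation c L) (hτ.contDiff_dilation c L)
    (hσ.dilation_add_one hd c L) (hτ.dilation_add_one hd c L)
    (integral_dilation hσ.smooth.continuous c L) (integral_dilation hτ.smooth.continuous c L) ?_
  intro s hs r h0
  have e : L • dir σ r = L • (meanDir σ + s • (dir σ r - dir τ r)
      - s • (meanDir σ - meanDir τ)) - c := by
    rw [← sub_eq_zero, ← h0]
    simp only [dilation, real_smul]
    push_cast
    ring
  have h1 : ‖s • (dir σ r - dir τ r)‖ ≤ δ := by
    rw [norm_smul, Real.norm_of_nonneg hs.1]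
    exact (mul_le_of_le_one_left (norm_nonneg _) hs.2).trans
      ((norm_exp_I_mul_sub_le _ _).trans (h r))
  have h2 : ‖s • (meanDir σ - meanDir τ)‖ ≤ δ := by
    rw [norm_smul, Real.norm_of_nonneg hs.1]
    exact (mul_le_of_le_one_left (norm_nonneg _) hs.2).trans
      (norm_meanDir_sub_le hσ.smooth.continuous hτ.smooth.continuous h)
  have h3 : ‖L • dir σ r‖ = L := by
    rw [norm_smul, dir, norm_exp_I_mul, mul_one, Real.norm_of_nonneg hL.1.le]
  have h4 : ‖L • dir σ r‖ ≤ L * (‖meanDir σ‖ + δ + δ) + ‖c‖ := by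
    rw [e]
    refine (norm_sub_le _ _).trans (add_le_add_left ?_ _)
    rw [norm_smul, Real.norm_of_nonneg hL.1.le]
    refine mul_le_mul_of_nonneg_left ?_ hL.1.le
    exact (norm_sub_le _ _).trans (add_le_add ((norm_add_le _ _).trans (by gcongr)) h2)
  rw [h3] at h4
  nlinarith [hL.2]

theorem IsVelocity.velConn_dilation {c : ℂ} {v : ℝ → ℂ} (hv : IsVelocity c v) {d : ℝ}
    (hd : exp (I * d) = 1) {σ : ℝ → ℝ} (hσ : IsAngle d σ)
    (hlift : ∀ r, v r = ‖v r‖ * exp (I * σ r)) (hm : ‖meanDir σ‖ < 1) :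
    ∀ᶠ L in atTop, VelConn c v (dilation c σ L) := by
  filter_upwards [eventually_norm_lt_mul c (a := 1 - ‖meanDir σ‖) (by linarith)] with L hL
  refine VelConn.of_segment hv.smooth (hσ.contDiff_dilation c L)
    hv.periodic (hσ.dilation_add_one hd c L) hv.mean
    (integral_dilation hσ.smooth.continuous c L) ?_
  intro s hs r h0
  have hpos : 0 < ‖v r‖ := norm_pos_iff.2 (hv.ne_zero r)
  have e : ((1 - s) * ‖v r‖ + s * L) • dir σ r = s • (L • meanDir σ - c) := by
    rw [← sub_eq_zero, ← h0]
    conv_rhs => rw [hlift r]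
    simp only [dilation, dir, real_smul]
    push_cast
    ring
  have hnn : 0 ≤ (1 - s) * ‖v r‖ := mul_nonneg (by linarith [hs.2]) hpos.le
  have hnn' : 0 ≤ s * L := mul_nonneg hs.1 hL.1.le
  have h1 := congrArg norm e
  rw [norm_smul, norm_smul, dir, norm_exp_I_mul, mul_one, Real.norm_of_nonneg hs.1,
    Real.norm_of_nonneg (add_nonneg hnn hnn')] at h1
  have h2 : ‖L • meanDir σ - c‖ ≤ L * ‖meanDir σ‖ + ‖c‖ := by
    refine (norm_sub_le _ _).trans ?_
    rw [norm_smul, Real.norm_of_nonneg hL.1.le]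
  rcases eq_or_lt_of_le hs.1 with h | h
  · rw [← h] at h1; simp at h1; exact hv.ne_zero r h1
  · have h3 : ‖L • meanDir σ - c‖ < L := by linarith [hL.2]
    have := mul_lt_mul_of_pos_left h3 h
    linarith

theorem IsAngle.convexComb {d : ℝ} {σ τ : ℝ → ℝ} (hσ : IsAngle d σ) (hτ : IsAngle d τ) (t : ℝ) :
    IsAngle d fun r => (1 - t) * σ r + t * τ r :=
  ⟨(contDiff_const.mul hσ.smooth).add (contDiff_const.mul hτ.smooth), fun r => by
    simp only [hσ.shift, hτ.shift]; ring⟩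

theorem velConn_dilation_of_convexComb {d : ℝ} (hd : exp (I * d) = 1) {σ τ : ℝ → ℝ}
    (hσ : IsAngle d σ) (hτ : IsAngle d τ) (c : ℂ)
    (hne : ∀ t ∈ Icc (0 : ℝ) 1, ∃ x y, (1 - t) * σ x + t * τ x ≠ (1 - t) * σ y + t * τ y) :
    ∀ᶠ L in atTop, VelConn c (dilation c σ L) (dilation c τ L) := by
  set A : ℝ → ℝ → ℝ := fun t r => (1 - t) * σ r + t * τ r with hA
  have hAngle : ∀ t, IsAngle d (A t) := hσ.convexComb hτ
  obtain ⟨B, hB⟩ : ∃ B, ∀ r, |σ r - τ r| ≤ B := by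
    have hper : Function.Periodic (fun r => σ r - τ r) 1 := fun r => by
      simp only [hσ.shift, hτ.shift]; ring
    obtain ⟨B, hB⟩ := (hper.isBounded_of_continuous one_ne_zero
      (hσ.smooth.continuous.sub hτ.smooth.continuous)).exists_norm_le
    exact ⟨B, fun r => hB _ ⟨r, rfl⟩⟩
  have key : ∀ᶠ L in atTop, VelConn c (dilation c (A 0) L) (dilation c (A 1) L) := by
    refine isPreconnected_Icc.induction₂
      (fun t u => ∀ᶠ L in atTop, VelConn c (dilation c (A t) L) (dilation c (A u) L))
      ?_ ?_ ?_ (left_mem_Icc.2 zero_le_one) (right_mem_Icc.2 zero_le_one)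
    · intro t ht
      have hm := (hAngle t).norm_meanDir_lt_one hd (hne t ht)
      have hlim : Tendsto (fun u => ‖meanDir (A t)‖ + 2 * (|u - t| * B)) (𝓝 t)
          (𝓝 (‖meanDir (A t)‖ + 2 * (|t - t| * B))) := by
        apply Continuous.tendsto; fun_prop
      have hev := hlim.eventually_lt_const (u := 1) (by simpa using hm)
      filter_upwards [nhdsWithin_le_nhds hev] with u hu
      refine velConn_dilation_of_close hd (hAngle t) (hAngle u) c (fun r => ?_) hu
      have : A t r - A u r = (u - t) * (σ r - τ r) := by simp only [hA]; ring
      rw [this, abs_mul]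
      exact mul_le_mul_of_nonneg_left (hB r) (abs_nonneg _)
    · intro x y z _ _ _ h1 h2
      filter_upwards [h1, h2] with L h1 h2 using SmoothConn.trans h1 h2
    · intro x y _ _ h
      filter_upwards [h] with L h using SmoothConn.symm h
  simpa [hA] using key


/-- A continuous logarithm of a nowhere vanishing curve `v`. -/
noncomputable def logLift (v : ℝ → ℂ) (r : ℝ) : ℂ :=
  log (v 0) + ∫ x in (0 : ℝ)..r, deriv v x / v x

section logLift

variable {v : ℝ → ℂ}

theorem contDiff_logDeriv (hv : ContDiff ℝ (⊤ : ℕ∞) v) (hne : ∀ r, v r ≠ 0) :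
    ContDiff ℝ (⊤ : ℕ∞) fun r => deriv v r / v r := by
  simp only [div_eq_mul_inv]
  exact (contDiff_infty_iff_deriv.1 hv).2.mul (hv.inv hne)

theorem hasDerivAt_logLift (hv : ContDiff ℝ (⊤ : ℕ∞) v) (hne : ∀ r, v r ≠ 0) (r : ℝ) :
    HasDerivAt (logLift v) (deriv v r / v r) r :=
  (hasDerivAt_primitive (contDiff_logDeriv hv hne).continuous r).const_add (log (v 0))

theorem contDiff_logLift (hv : ContDiff ℝ (⊤ : ℕ∞) v) (hne : ∀ r, v r ≠ 0) :
    ContDiff ℝ (⊤ : ℕ∞) (logLift v) :=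
  contDiff_of_hasDerivAt (hasDerivAt_logLift hv hne) (contDiff_logDeriv hv hne)

theorem exp_logLift (hv : ContDiff ℝ (⊤ : ℕ∞) v) (hne : ∀ r, v r ≠ 0) (r : ℝ) :
    exp (logLift v r) = v r := by
  have hd : ∀ x, HasDerivAt (fun x => v x * exp (-logLift v x)) 0 x := by
    intro x
    have h1 := (hv.differentiable (by simp) x).hasDerivAt
    have h2 := (hasDerivAt_logLift hv hne x).neg.cexp
    refine (h1.mul h2).congr_deriv ?_
    have := hne x
    field_simp
    ring
  have hconst := is_const_of_deriv_eq_zero (fun x => (hd x).differentiableAt)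
    (fun x => (hd x).deriv) r 0
  have h0 : exp (logLift v 0) = v 0 := by simp [logLift, exp_log (hne 0)]
  simp only [exp_neg, h0] at hconst
  rw [mul_inv_cancel₀ (hne 0), mul_inv_eq_one₀ (exp_ne_zero _)] at hconst
  exact hconst.symm

theorem eq_norm_mul_exp_of_eq {z : ℂ} {a θ : ℝ} (ha : 0 ≤ a) (hz : z = a * exp (I * θ)) :
    z = ‖z‖ * exp (I * θ) := by
  have : ‖z‖ = a := by rw [hz, norm_mul, norm_exp_I_mul, mul_one, norm_real, Real.norm_of_nonneg ha]
  rw [this, hz]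

theorem eq_norm_mul_exp_im_logLift (hv : ContDiff ℝ (⊤ : ℕ∞) v) (hne : ∀ r, v r ≠ 0) (r : ℝ) :
    v r = ‖v r‖ * exp (I * ((logLift v r).im : ℝ)) := by
  refine eq_norm_mul_exp_of_eq (Real.exp_pos (logLift v r).re).le ?_
  rw [← exp_logLift hv hne r, ofReal_exp, ← exp_add]
  conv_lhs => rw [← re_add_im (logLift v r), mul_comm _ I]

end logLift

theorem exp_I_mul_eq_of_lift {z : ℂ} (hz : z ≠ 0) {a b : ℝ} (ha : z = ‖z‖ * exp (I * a))
    (hb : z = ‖z‖ * exp (I * b)) : exp (I * a) = exp (I * b) :=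
  mul_left_cancel₀ (by exact_mod_cast norm_ne_zero_iff.2 hz) (ha.symm.trans hb)

/-- Continuous angle functions of velocity fields are smooth and have a well-defined increment. -/
theorem IsVelocity.isAngle {c : ℂ} {v : ℝ → ℂ} (hv : IsVelocity c v) {σ : ℝ → ℝ}
    (hσ : Continuous σ) (hlift : ∀ r, v r = ‖v r‖ * exp (I * σ r)) :
    IsAngle (σ 1 - σ 0) σ ∧ exp (I * (σ 1 - σ 0 : ℝ)) = 1 := by
  have hφ : ContDiff ℝ (⊤ : ℕ∞) fun r => (logLift v r).im :=
    imCLM.contDiff.comp (contDiff_logLift hv.smooth hv.ne_zero)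
  have h1 := sub_eq_of_exp_I_mul_eq hσ hφ.continuous fun r =>
    exp_I_mul_eq_of_lift (hv.ne_zero r) (hlift r)
      (eq_norm_mul_exp_im_logLift hv.smooth hv.ne_zero r)
  have hexp : ∀ r, exp (I * σ (r + 1)) = exp (I * σ r) := fun r =>
    exp_I_mul_eq_of_lift (hv.ne_zero r) (by rw [← hv.periodic r]; exact hlift (r + 1)) (hlift r)
  have h2 := sub_eq_of_exp_I_mul_eq (hσ.comp (continuous_add_const 1)) hσ hexp
  refine ⟨⟨?_, fun r => ?_⟩, ?_⟩
  · have : σ = fun r => (logLift v r).im + (σ 0 - (logLift v 0).im) :=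
      funext fun r => by linarith [h1 r]
    rw [this]
    exact hφ.add contDiff_const
  · have := h2 r
    simp only [Function.comp, zero_add] at this
    linarith
  · have := hexp 0
    rw [zero_add] at this
    rw [ofReal_sub, mul_sub, exp_sub, this, div_self (exp_ne_zero _)]

/-- The angle function `r ↦ sin (2πr)`. -/
noncomputable def sinAngle (r : ℝ) : ℝ := Real.sin (2 * Real.pi * r)

/-- The angle function `r ↦ cos (2πr)`. -/
noncomputable def cosAngle (r : ℝ) : ℝ := Real.cos (2 * Real.pi * r)

theorem isAngle_sinAngle : IsAngle 0 sinAngle := by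
  refine ⟨Real.contDiff_sin.comp (contDiff_const.mul contDiff_id), fun r => ?_⟩
  rw [sinAngle, mul_add, mul_one, Real.sin_add_two_pi, add_zero, sinAngle]

theorem isAngle_cosAngle : IsAngle 0 cosAngle := by
  refine ⟨Real.contDiff_cos.comp (contDiff_const.mul contDiff_id), fun r => ?_⟩
  rw [cosAngle, mul_add, mul_one, Real.cos_add_two_pi, add_zero, cosAngle]

theorem IsAngle.neg {σ : ℝ → ℝ} (hσ : IsAngle 0 σ) : IsAngle 0 fun r => -σ r :=
  ⟨hσ.smooth.neg, fun r => by simp [hσ.shift]⟩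

theorem exp_I_mul_zero : exp (I * (0 : ℝ)) = 1 := by simp

theorem sinAngle_zero : sinAngle 0 = 0 := by simp [sinAngle]

theorem sinAngle_quarter : sinAngle (1 / 4) = 1 := by
  rw [sinAngle, show 2 * Real.pi * (1 / 4) = Real.pi / 2 by ring, Real.sin_pi_div_two]

theorem sinAngle_half : sinAngle (1 / 2) = 0 := by
  rw [sinAngle, show 2 * Real.pi * (1 / 2) = Real.pi by ring, Real.sin_pi]

theorem cosAngle_zero : cosAngle 0 = 1 := by simp [cosAngle]

theorem cosAngle_half : cosAngle (1 / 2) = -1 := by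
  rw [cosAngle, show 2 * Real.pi * (1 / 2) = Real.pi by ring, Real.cos_pi]

/-- `ε sin (2πr)`, with `ε = ±1`, can be deformed to `cos (2πr)` through nonconstant angles. -/
theorem velConn_sin_cos (c : ℂ) {σ : ℝ → ℝ} (hσ : IsAngle 0 σ) (h0 : σ 0 = 0)
    (h2 : σ (1 / 2) = 0) (h4 : σ (1 / 4) ≠ 0) :
    ∀ᶠ L in atTop, VelConn c (dilation c σ L) (dilation c cosAngle L) := by
  refine velConn_dilation_of_convexComb exp_I_mul_zero hσ isAngle_cosAngle c ?_
  intro t _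
  by_cases ht : t = 0
  · exact ⟨0, 1 / 4, by simpa [ht, h0] using h4.symm⟩
  · refine ⟨0, 1 / 2, fun h => ht ?_⟩
    rw [h0, h2, cosAngle_zero, cosAngle_half] at h
    linarith

theorem velConn_dilation_sinAngle (c : ℂ) {σ : ℝ → ℝ} (hσ : IsAngle 0 σ)
    (hne : ∃ x y, σ x ≠ σ y) :
    ∀ᶠ L in atTop, VelConn c (dilation c σ L) (dilation c sinAngle L) := by
  obtain ⟨x, y, hxy⟩ := hne
  have key : ∀ τ : ℝ → ℝ, 0 ≤ (σ x - σ y) * (τ x - τ y) → τ 0 ≠ τ (1 / 4) →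
      ∀ t ∈ Icc (0 : ℝ) 1, ∃ x y, (1 - t) * σ x + t * τ x ≠ (1 - t) * σ y + t * τ y := by
    intro τ hτ hτ' t ht
    rcases eq_or_lt_of_le ht.2 with h1 | h1
    · exact ⟨0, 1 / 4, by simpa [h1] using hτ'⟩
    · refine ⟨x, y, fun h => ?_⟩
      have e : (1 - t) * (σ x - σ y) ^ 2 + t * ((σ x - σ y) * (τ x - τ y)) = 0 := by
        linear_combination (σ x - σ y) * h
      have := mul_pos (sub_pos.2 h1) (sq_pos_of_ne_zero (sub_ne_zero.2 hxy))
      have := mul_nonneg ht.1 hτ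
      linarith
  rcases le_total 0 ((σ x - σ y) * (sinAngle x - sinAngle y)) with h | h
  · exact velConn_dilation_of_convexComb exp_I_mul_zero hσ isAngle_sinAngle c
      (key _ h (by norm_num [sinAngle_zero, sinAngle_quarter]))
  · have h1 := velConn_dilation_of_convexComb exp_I_mul_zero hσ isAngle_sinAngle.neg c
      (key _ (by linarith) (by norm_num [sinAngle_zero, sinAngle_quarter]))
    have h2 := velConn_sin_cos c isAngle_sinAngle.neg (by simp [sinAngle_zero])
      (by simpa using sinAngle_half) (by norm_num [sinAngle_quarter])
    have h3 := velConn_sin_cos c isAngle_sinAngle sinAngle_zero sinAngle_half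
      (by norm_num [sinAngle_quarter])
    filter_upwards [h1, h2, h3] with L h1 h2 h3
    exact (SmoothConn.trans h1 h2).trans (SmoothConn.symm h3)

theorem one_add_I_mul_eq (x : ℝ) :
    1 + I * x = (√(1 + x ^ 2) : ℝ) * exp (I * Real.arctan x) := by
  have h : √(1 + x ^ 2) ≠ 0 := (Real.sqrt_pos.2 (by positivity)).ne'
  have h' : ((√(1 + x ^ 2) : ℝ) : ℂ) ≠ 0 := by exact_mod_cast h
  rw [mul_comm I (Real.arctan x : ℂ), exp_mul_I, ← ofReal_cos, ← ofReal_sin, Real.cos_arctan,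
    Real.sin_arctan]
  push_cast
  field_simp

theorem integral_sinAngle : ∫ x in (0 : ℝ)..1, sinAngle x = 0 := by
  unfold sinAngle
  rw [intervalIntegral.integral_comp_mul_left (fun y => Real.sin y) (by positivity)]
  simp

/-- A velocity field of constant direction can be deformed to one whose direction varies. -/
theorem IsVelocity.exists_nonconst {c : ℂ} {v : ℝ → ℂ} (hv : IsVelocity c v) {α : ℝ}
    (hlift : ∀ r, v r = ‖v r‖ * exp (I * α)) :
    ∃ (w : ℝ → ℂ) (τ : ℝ → ℝ), IsVelocity c w ∧ IsAngle 0 τ ∧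
      (∀ r, w r = ‖w r‖ * exp (I * τ r)) ∧ (∃ x y, τ x ≠ τ y) ∧ VelConn c v w := by
  have hpos : ∀ r, 0 < ‖v r‖ := fun r => norm_pos_iff.2 (hv.ne_zero r)
  set w : ℝ → ℂ := fun r => v r + sinAngle r • (I * exp (I * α)) with hw
  set τ : ℝ → ℝ := fun r => α + Real.arctan (sinAngle r / ‖v r‖) with hτ
  have hwsm : ContDiff ℝ (⊤ : ℕ∞) w :=
    hv.smooth.add (isAngle_sinAngle.smooth.smul contDiff_const)
  have hsin : ∀ r, sinAngle (r + 1) = sinAngle r := fun r => by simp [isAngle_sinAngle.shift]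
  have hwper : ∀ r, w (r + 1) = w r := fun r => by simp only [hw, hv.periodic, hsin]
  have hwmean : ∫ x in (0 : ℝ)..1, w x = c := by
    rw [hw, intervalIntegral.integral_add (g := fun x => sinAngle x • (I * exp (I * α)))
      (hv.smooth.continuous.intervalIntegrable _ _)
      ((isAngle_sinAngle.smooth.continuous.smul continuous_const).intervalIntegrable _ _),
      hv.mean, intervalIntegral.integral_smul_const, integral_sinAngle, zero_smul, add_zero]
  have hseg : ∀ s : ℝ, ∀ r, (1 - s) • v r + s • w r ≠ 0 := by
    intro s r h0
    have e : (‖v r‖ + (s * sinAngle r : ℝ) * I) * exp (I * α) = 0 := by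
      rw [← h0]
      simp only [hw, real_smul]
      conv_rhs => rw [hlift r]
      push_cast
      ring
    have := (mul_eq_zero.1 e).resolve_right (exp_ne_zero _)
    have h1 := congrArg re this
    simp at h1
    exact hv.ne_zero r h1
  refine ⟨w, τ, ⟨hwsm, fun r => by simpa using hseg 1 r, hwper, hwmean⟩, ⟨?_, fun r => ?_⟩,
    fun r => ?_, ⟨0, 1 / 4, ?_⟩, ?_⟩
  · exact contDiff_const.add (Real.contDiff_arctan.comp
      (isAngle_sinAngle.smooth.div (hv.smooth.norm ℝ hv.ne_zero) fun r => (hpos r).ne'))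
  · simp only [hτ, hsin, hv.periodic, add_zero]
  · refine eq_norm_mul_exp_of_eq
      (a := ‖v r‖ * √(1 + (sinAngle r / ‖v r‖) ^ 2)) (by positivity) ?_
    have h1 := one_add_I_mul_eq (sinAngle r / ‖v r‖)
    have hn : (‖v r‖ : ℂ) ≠ 0 := by exact_mod_cast (hpos r).ne'
    rw [ofReal_mul, hτ, ofReal_add, mul_add, exp_add, mul_mul_mul_comm, ← h1, ← hlift r, hw,
      mul_add, mul_one]
    simp only [real_smul]
    nth_rewrite 2 [hlift r]
    push_cast
    field_simp
    linear_combination (‖v r‖ - sinAngle r * I) * hlift r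
  · have h1 : 0 < Real.arctan (1 / ‖v (1 / 4)‖) := Real.arctan_pos.2 (one_div_pos.2 (hpos _))
    simp only [hτ, sinAngle_zero, sinAngle_quarter, zero_div, Real.arctan_zero]
    linarith
  · exact VelConn.of_segment hv.smooth hwsm hv.periodic hwper hv.mean hwmean fun s _ => hseg s

theorem IsVelocity.velConn_sinAngle {c : ℂ} {v : ℝ → ℂ} (hv : IsVelocity c v) {σ : ℝ → ℝ}
    (hσ : IsAngle 0 σ) (hlift : ∀ r, v r = ‖v r‖ * exp (I * σ r)) :
    ∀ᶠ L in atTop, VelConn c v (dilation c sinAngle L) := by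
  have nonconst : ∀ {w : ℝ → ℂ} {τ : ℝ → ℝ}, IsVelocity c w → IsAngle 0 τ →
      (∀ r, w r = ‖w r‖ * exp (I * τ r)) → (∃ x y, τ x ≠ τ y) →
      ∀ᶠ L in atTop, VelConn c w (dilation c sinAngle L) := by
    intro w τ hw hτ hl hne
    filter_upwards [hw.velConn_dilation exp_I_mul_zero hτ hl
      (hτ.norm_meanDir_lt_one exp_I_mul_zero hne), velConn_dilation_sinAngle c hτ hne]
      with L h1 h2 using SmoothConn.trans h1 h2
  by_cases hne : ∃ x y, σ x ≠ σ y
  · exact nonconst hv hσ hlift hne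
  · push Not at hne
    obtain ⟨w, τ, hw, hτ, hl, hn, hvw⟩ :=
      hv.exists_nonconst (α := σ 0) fun r => by rw [← hne r 0]; exact hlift r
    filter_upwards [nonconst hw hτ hl hn] with L h using SmoothConn.trans hvw h

/-- Velocity fields with the same mean and the same degree are connected. -/
theorem IsVelocity.velConn {c : ℂ} {v w : ℝ → ℂ} (hv : IsVelocity c v) (hw : IsVelocity c w)
    {d : ℝ} (hd : exp (I * d) = 1) {σ τ : ℝ → ℝ} (hσ : IsAngle d σ) (hτ : IsAngle d τ)
    (hvσ : ∀ r, v r = ‖v r‖ * exp (I * σ r)) (hwτ : ∀ r, w r = ‖w r‖ * exp (I * τ r)) :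
    VelConn c v w := by
  by_cases h0 : d = 0
  · subst h0
    obtain ⟨L, h1, h2⟩ :=
      ((hv.velConn_sinAngle hσ hvσ).and (hw.velConn_sinAngle hτ hwτ)).exists
    exact SmoothConn.trans h1 (SmoothConn.symm h2)
  · have hne : ∀ {ρ : ℝ → ℝ}, IsAngle d ρ → ∃ x y, ρ x ≠ ρ y := fun {ρ} hρ =>
      ⟨0 + 1, 0, by rw [hρ.shift]; simpa using h0⟩
    obtain ⟨L, h1, h2, h3⟩ :=
      ((hv.velConn_dilation hd hσ hvσ (hσ.norm_meanDir_lt_one hd (hne hσ))).and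
        ((hw.velConn_dilation hd hτ hwτ (hτ.norm_meanDir_lt_one hd (hne hτ))).and
        (velConn_dilation_of_convexComb hd hσ hτ c fun t _ => hne (hσ.convexComb hτ t)))).exists
    exact (SmoothConn.trans h1 h3).trans (SmoothConn.symm h2)

theorem hasDerivAt_uncurry_right {F : ℝ → ℝ → ℂ}
    (hF : ContDiff ℝ (⊤ : ℕ∞) (Function.uncurry F)) (t r : ℝ) :
    HasDerivAt (F t) (fderiv ℝ (Function.uncurry F) (t, r) (0, 1)) r := by
  have h1 := (hF.differentiable (by simp) (t, r)).hasFDerivAt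
  have h2 : HasDerivAt (fun r : ℝ => (t, r)) ((0 : ℝ), (1 : ℝ)) r :=
    (hasDerivAt_const r t).prodMk (hasDerivAt_id r)
  exact h1.comp_hasDerivAt r h2

theorem contDiff_uncurry_deriv {F : ℝ → ℝ → ℂ}
    (hF : ContDiff ℝ (⊤ : ℕ∞) (Function.uncurry F)) :
    ContDiff ℝ (⊤ : ℕ∞) (Function.uncurry fun t => deriv (F t)) := by
  have h : (Function.uncurry fun t => deriv (F t))
      = fun p : ℝ × ℝ => fderiv ℝ (Function.uncurry F) p (0, 1) :=
    funext fun p => (hasDerivAt_uncurry_right hF p.1 p.2).deriv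
  rw [h]
  exact (hF.fderiv_right (m := (⊤ : ℕ∞)) (by simp)).clm_apply contDiff_const

/-- The total angle swept by a velocity field is invariant under homotopy. -/
theorem im_logLift_sub_eq {V : ℝ → ℝ → ℂ} (hV : ContDiff ℝ (⊤ : ℕ∞) (Function.uncurry V))
    (hne : ∀ t ∈ Icc (0 : ℝ) 1, ∀ r, V t r ≠ 0)
    (hper : ∀ t ∈ Icc (0 : ℝ) 1, ∀ r, V t (r + 1) = V t r) :
    (logLift (V 0) 1).im - (logLift (V 0) 0).im = (logLift (V 1) 1).im - (logLift (V 1) 0).im := by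
  set s := Real.smoothTransition
  have hs : ∀ t, s t ∈ Icc (0 : ℝ) 1 := fun t =>
    ⟨Real.smoothTransition.nonneg _, Real.smoothTransition.le_one _⟩
  have hsec : ∀ t, ContDiff ℝ (⊤ : ℕ∞) (V t) := fun t => hV.comp (contDiff_prodMk_right t)
  have hsc : Continuous fun p : ℝ × ℝ => (s p.1, p.2) :=
    (Real.smoothTransition.continuous.comp continuous_fst).prodMk continuous_snd
  set D : ℝ → ℝ := fun t => (∫ x in (0 : ℝ)..1, deriv (V (s t)) x / V (s t) x).im with hD
  have hDlift : ∀ t, (logLift (V (s t)) 1).im - (logLift (V (s t)) 0).im = D t := fun t => by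
    simp [logLift, hD]
  have hDc : Continuous D := by
    refine continuous_im.comp
      (intervalIntegral.continuous_parametric_intervalIntegral_of_continuous' ?_ 0 1)
    exact ((contDiff_uncurry_deriv hV).continuous.comp hsc).div (hV.continuous.comp hsc)
      fun p => hne _ (hs p.1) p.2
  have hDexp : ∀ t, exp (I * D t) = 1 := by
    intro t
    have hvel : IsVelocity (∫ x in (0 : ℝ)..1, V (s t) x) (V (s t)) :=
      ⟨hsec _, hne _ (hs t), hper _ (hs t), rfl⟩
    rw [← hDlift t]
    exact (hvel.isAngle
      (continuous_im.comp (contDiff_logLift (hsec _) (hne _ (hs t))).continuous)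
      (eq_norm_mul_exp_im_logLift (hsec _) (hne _ (hs t)))).2
  have hconst := eq_of_exp_I_mul_eq hDc (fun t => (hDexp t).trans (hDexp 0).symm) 1
  have h0 := hDlift 0
  have h1 := hDlift 1
  rw [show s 0 = 0 from Real.smoothTransition.zero] at h0
  rw [show s 1 = 1 from Real.smoothTransition.one] at h1
  rw [h0, h1, hconst]

end StableHomotopy


/-- two `T²`-invariant stable Hamiltonian structures on `T³`
(encoded by pairs `(h_j, g_j)` with `h_j'` nowhere zero and 1-periodic, `g_j`
1-periodic, satisfying the stabilization conditions) with the same cohomology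
class `h_j(1) − h_j(0)` are connected by a stable homotopy through such pairs
with constant cohomology class iff their slopes have the same degree. -/
theorem stmt17 (h₀ h₁ g₀ g₁ : ℝ → ℂ)
    (h₀_sm : ContDiff ℝ (⊤ : ℕ∞) h₀) (h₁_sm : ContDiff ℝ (⊤ : ℕ∞) h₁)
    (g₀_sm : ContDiff ℝ (⊤ : ℕ∞) g₀) (g₁_sm : ContDiff ℝ (⊤ : ℕ∞) g₁)
    (himm0 : ∀ r : ℝ, deriv h₀ r ≠ 0) (himm1 : ∀ r : ℝ, deriv h₁ r ≠ 0)
    (hper0 : ∀ r : ℝ, deriv h₀ (r + 1) = deriv h₀ r)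
    (hper1 : ∀ r : ℝ, deriv h₁ (r + 1) = deriv h₁ r)
    (gper0 : ∀ r : ℝ, g₀ (r + 1) = g₀ r)
    (gper1 : ∀ r : ℝ, g₁ (r + 1) = g₁ r)
    (hstab0 : ∀ r : ℝ, rinner (deriv g₀ r) (Complex.I * deriv h₀ r) = 0 ∧
      0 < rinner (g₀ r) (Complex.I * deriv h₀ r))
    (hstab1 : ∀ r : ℝ, rinner (deriv g₁ r) (Complex.I * deriv h₁ r) = 0 ∧
      0 < rinner (g₁ r) (Complex.I * deriv h₁ r))
    (hcoh : h₀ 1 - h₀ 0 = h₁ 1 - h₁ 0) :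
    ((∃ H G : ℝ → ℝ → ℂ,
        ContDiff ℝ (⊤ : ℕ∞) (Function.uncurry H) ∧
        ContDiff ℝ (⊤ : ℕ∞) (Function.uncurry G) ∧
        (∀ r : ℝ, H 0 r = h₀ r ∧ G 0 r = g₀ r ∧ H 1 r = h₁ r ∧ G 1 r = g₁ r) ∧
        (∀ t ∈ Set.Icc (0:ℝ) 1,
          (∀ r : ℝ, deriv (H t) r ≠ 0) ∧
          (∀ r : ℝ, deriv (H t) (r + 1) = deriv (H t) r) ∧
          (∀ r : ℝ, G t (r + 1) = G t r) ∧
          (∀ r : ℝ, rinner (deriv (G t) r) (Complex.I * deriv (H t) r) = 0 ∧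
            0 < rinner (G t r) (Complex.I * deriv (H t) r)) ∧
          H t 1 - H t 0 = h₀ 1 - h₀ 0)) ↔
      (∃ σ₀ σ₁ : ℝ → ℝ, Continuous σ₀ ∧ Continuous σ₁ ∧
        (∀ r : ℝ, deriv h₀ r = (‖deriv h₀ r‖ : ℂ) * Complex.exp (Complex.I * (σ₀ r : ℂ))) ∧
        (∀ r : ℝ, deriv h₁ r = (‖deriv h₁ r‖ : ℂ) * Complex.exp (Complex.I * (σ₁ r : ℂ))) ∧
        σ₀ 1 - σ₀ 0 = σ₁ 1 - σ₁ 0)) := by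
  have hs0 : StableHomotopy.IsStable (h₀ 1 - h₀ 0) h₀ g₀ := ⟨himm0, hper0, gper0, hstab0, rfl⟩
  have hs1 : StableHomotopy.IsStable (h₀ 1 - h₀ 0) h₁ g₁ := ⟨himm1, hper1, gper1, hstab1, hcoh.symm⟩
  have hv0 := StableHomotopy.isVelocity_deriv h₀_sm hs0
  have hv1 := StableHomotopy.isVelocity_deriv h₁_sm hs1
  constructor
  · rintro ⟨H, G, hH, -, hends, hP⟩
    have e0 : H 0 = h₀ := funext fun r => (hends r).1
    have e1 : H 1 = h₁ := funext fun r => (hends r).2.2.1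
    have hdeg := StableHomotopy.im_logLift_sub_eq (StableHomotopy.contDiff_uncurry_deriv hH)
      (fun t ht => (hP t ht).1) (fun t ht => (hP t ht).2.1)
    rw [e0, e1] at hdeg
    exact ⟨fun r => (StableHomotopy.logLift (deriv h₀) r).im,
      fun r => (StableHomotopy.logLift (deriv h₁) r).im,
      Complex.continuous_im.comp
        (StableHomotopy.contDiff_logLift hv0.smooth himm0).continuous,
      Complex.continuous_im.comp
        (StableHomotopy.contDiff_logLift hv1.smooth himm1).continuous,
      StableHomotopy.eq_norm_mul_exp_im_logLift hv0.smooth himm0,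
      StableHomotopy.eq_norm_mul_exp_im_logLift hv1.smooth himm1, hdeg⟩
  · rintro ⟨σ₀, σ₁, hc0, hc1, hl0, hl1, hdeg⟩
    obtain ⟨ha0, hd⟩ := hv0.isAngle hc0 hl0
    have ha1 := (hv1.isAngle hc1 hl1).1
    rw [← hdeg] at ha1
    exact ((hs0.smoothConn_primitive h₀_sm g₀_sm).trans
      (hv0.velConn hv1 hd ha0 ha1 hl0 hl1)).trans (hs1.smoothConn_primitive h₁_sm g₁_sm).symm
end

section
/- Let [a,b] ⊆ ℝ and let h : [a,b] → ℂ be a smooth immersion whose slope twists, in the following sense: there exists an argument lift σ : [a,b] → ℝ of h' and points r₁ < r₂ and r₃ < r₄ in [a,b] with σ(r₂) − σ(r₁) ≥ 2π and σ(r₄) − σ(r₃) ≤ −2π (the slope makes at least one full counterclockwise and one full clockwise turn). Then there exists r ∈ [a,b] with ⟨h(r), i·h'(r)⟩ = 0; equivalently, the 1-form α_h = h₁ dθ + h₂ dφ is not a contact form. -/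
open Set in
/-- A continuous real function on a segment with positive sine varies by less than `π`. -/
theorem sub_lt_pi_of_sin_pos {a b : ℝ} {θ : ℝ → ℝ} (hab : a ≤ b) (hθ : ContinuousOn θ (Icc a b))
    (hsin : ∀ r ∈ Icc a b, 0 < Real.sin (θ r)) : θ a - θ b < Real.pi := by
  by_contra! hcon
  obtain ⟨z, hz, hzb⟩ := intermediate_value_Icc' hab hθ
    (show θ b + Real.pi ∈ Icc (θ b) (θ a) from ⟨by linarith [Real.pi_pos], by linarith⟩)
  have h1 := hsin z hz
  rw [hzb, Real.sin_add_pi] at h1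
  linarith [hsin b (right_mem_Icc.2 hab)]

open Set in
/-- A nowhere vanishing `C¹` curve in `ℂ` has a `C¹` logarithm. -/
theorem exists_hasDerivAt_log {a b : ℝ} (hab : a ≤ b) {h h' : ℝ → ℂ}
    (hd : ∀ r, HasDerivAt h (h' r) r) (hc : Continuous h') (h0 : ∀ r ∈ Icc a b, h r ≠ 0) :
    ∃ L : ℝ → ℂ, (∀ r ∈ Icc a b, HasDerivAt L (h' r / h r) r) ∧
      ∀ r ∈ Icc a b, h r = Complex.exp (L r) := by
  have hcont : Continuous h := continuous_iff_continuousAt.2 fun r => (hd r).continuousAt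
  set g : ℝ → ℂ := IccExtend hab ((Icc a b).domRestrict fun r => h' r / h r)
  have hg : Continuous g :=
    (continuousOn_iff_continuous_domRestrict.1 (hc.continuousOn.div hcont.continuousOn h0)).Icc_extend'
  have hgr : ∀ r ∈ Icc a b, g r = h' r / h r := fun r hr => IccExtend_of_mem hab _ hr
  set L : ℝ → ℂ := fun r => Complex.log (h a) + ∫ t in a..r, g t with hL
  have hLd : ∀ r, HasDerivAt L (g r) r := fun r =>
    (hg.integral_hasStrictDerivAt a r).hasDerivAt.const_add _
  have hprod : ∀ r ∈ Icc a b, HasDerivAt (fun t => h t * Complex.exp (-L t)) 0 r := fun r hr => by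
    refine ((hd r).mul (hLd r).neg.cexp).congr_deriv ?_
    rw [hgr r hr]
    field_simp [h0 r hr]
    ring
  refine ⟨L, fun r hr => hgr r hr ▸ hLd r, fun r hr => ?_⟩
  have hconst := constant_of_has_deriv_right_zero
    (fun r hr => (hprod r hr).continuousAt.continuousWithinAt)
    (fun r hr => (hprod r (Ico_subset_Icc_self hr)).hasDerivWithinAt) r hr
  have ha : Complex.exp (L a) = h a := by
    simp [hL, Complex.exp_log (h0 a (left_mem_Icc.2 hab))]
  rw [Complex.exp_neg, Complex.exp_neg, ha, mul_inv_cancel₀ (h0 a (left_mem_Icc.2 hab))] at hconst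
  field_simp [Complex.exp_ne_zero] at hconst
  exact hconst

open Set ComplexConjugate in
/-- If `h` turns clockwise around the origin, then the slope of `h` increases by less than `π`. -/
theorem slope_sub_lt_pi {a b : ℝ} (hab : a ≤ b) {h h' : ℝ → ℂ} {σ : ℝ → ℝ}
    (hd : ∀ r, HasDerivAt h (h' r) r) (hc : Continuous h') (hσ : ContinuousOn σ (Icc a b))
    (hlift : ∀ r ∈ Icc a b, h' r = (‖h' r‖ : ℂ) * Complex.exp (Complex.I * (σ r : ℂ)))
    (hpos : ∀ r ∈ Icc a b, 0 < (h r * conj (h' r)).im) : σ b - σ a < Real.pi := by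
  have h0 : ∀ r ∈ Icc a b, h r ≠ 0 := fun r hr hz => by simpa [hz] using hpos r hr
  obtain ⟨L, hLd, hL⟩ := exists_hasDerivAt_log hab hd hc h0
  have him : ∀ r ∈ Icc a b, HasDerivAt (fun t => (L t).im) (h' r / h r).im r := fun r hr =>
    Complex.imCLM.hasFDerivAt.comp_hasDerivAt r (hLd r hr)
  have hcont : ContinuousOn (fun t => (L t).im) (Icc a b) := fun r hr =>
    (him r hr).continuousAt.continuousWithinAt
  have hanti : AntitoneOn (fun t => (L t).im) (Icc a b) := by
    refine antitoneOn_of_hasDerivWithinAt_nonpos (convex_Icc a b) hcont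
      (fun r hr => (him r (interior_subset hr)).hasDerivWithinAt) fun r hr => ?_
    have hp := hpos r (interior_subset hr)
    have hn := Complex.normSq_nonneg (h r)
    rw [Complex.div_im, ← sub_div]
    refine div_nonpos_of_nonpos_of_nonneg ?_ hn
    simp only [Complex.mul_im, Complex.conj_re, Complex.conj_im] at hp
    linarith
  have hsin : ∀ r ∈ Icc a b, 0 < Real.sin ((L r).im - σ r) := fun r hr => by
    have hp := hpos r hr
    have he : h r * conj (h' r) = (‖h' r‖ : ℂ) * Complex.exp (L r - Complex.I * σ r) := by
      conv_lhs => rw [hlift r hr, hL r hr]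
      rw [map_mul, ← Complex.exp_conj, mul_left_comm, ← Complex.exp_add]
      simp [sub_eq_add_neg]
    rw [he, Complex.im_ofReal_mul, Complex.exp_im, ← mul_assoc] at hp
    have hpn := pos_of_mul_pos_right hp (by positivity)
    simpa using hpn
  have hlt := sub_lt_pi_of_sin_pos hab (hcont.sub hσ) hsin
  have hle := hanti (left_mem_Icc.2 hab) (right_mem_Icc.2 hab) hab
  simp only [Pi.sub_apply] at hlt hle
  linarith

/-- twisting slope is not contact: if the slope of the
immersion `h : [a,b] → ℂ` makes a full counterclockwise turn and a full
clockwise turn (in terms of an argument lift `σ` of `h'`), then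
`⟨h(r), i·h'(r)⟩ = 0` for some `r ∈ [a,b]`, i.e. the associated 1-form
`α_h = h₁ dθ + h₂ dφ` is not a contact form. -/
theorem stmt18 (a b : ℝ) (hab : a < b) (h : ℝ → ℂ)
    (h_sm : ContDiff ℝ (⊤ : ℕ∞) h)
    (himm : ∀ r ∈ Set.Icc a b, deriv h r ≠ 0)
    (σ : ℝ → ℝ) (hσc : ContinuousOn σ (Set.Icc a b))
    (hlift : ∀ r ∈ Set.Icc a b,
      deriv h r = (‖deriv h r‖ : ℂ) * Complex.exp (Complex.I * (σ r : ℂ)))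
    (r₁ r₂ r₃ r₄ : ℝ) (h12 : r₁ < r₂) (h34 : r₃ < r₄)
    (hr₁ : r₁ ∈ Set.Icc a b) (hr₂ : r₂ ∈ Set.Icc a b)
    (hr₃ : r₃ ∈ Set.Icc a b) (hr₄ : r₄ ∈ Set.Icc a b)
    (htw1 : 2 * Real.pi ≤ σ r₂ - σ r₁)
    (htw2 : σ r₄ - σ r₃ ≤ -(2 * Real.pi)) :
    ∃ r ∈ Set.Icc a b, rinner (h r) (Complex.I * deriv h r) = 0 := by
  by_contra! hne
  have hd : ∀ r, HasDerivAt h (deriv h r) r := fun r =>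
    (h_sm.differentiable (by simp) r).hasDerivAt
  have hc : Continuous (deriv h) := h_sm.continuous_deriv (by simp)
  have hf : ∀ r, rinner (h r) (Complex.I * deriv h r)
      = (h r * (starRingEnd ℂ) (deriv h r)).im := fun r => by
    simp [rinner]
    ring
  simp only [hf] at hne
  have hcont : Continuous fun r => (h r * (starRingEnd ℂ) (deriv h r)).im :=
    Complex.continuous_im.comp (h_sm.continuous.mul (Complex.continuous_conj.comp hc))
  have hsub : ∀ {x y : ℝ}, x ∈ Set.Icc a b → y ∈ Set.Icc a b → Set.Icc x y ⊆ Set.Icc a b :=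
    fun hx hy => Set.Icc_subset_Icc hx.1 hy.2
  obtain ⟨s, hs, hs0⟩ : ∃ s ∈ Set.Icc a b, (h s * (starRingEnd ℂ) (deriv h s)).im ≤ 0 := by
    by_contra! hpos
    have := slope_sub_lt_pi h12.le hd hc (hσc.mono (hsub hr₁ hr₂))
      (fun r hr => hlift r (hsub hr₁ hr₂ hr)) fun r hr => hpos r (hsub hr₁ hr₂ hr)
    linarith [Real.pi_pos]
  obtain ⟨t, ht, ht0⟩ : ∃ t ∈ Set.Icc a b, 0 ≤ (h t * (starRingEnd ℂ) (deriv h t)).im := by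
    by_contra! hneg
    have := slope_sub_lt_pi (h := fun r => (starRingEnd ℂ) (h r))
      (h' := fun r => (starRingEnd ℂ) (deriv h r)) (σ := fun r => -σ r) h34.le
      (fun r => Complex.conjCLE.toContinuousLinearMap.hasFDerivAt.comp_hasDerivAt r (hd r))
      (Complex.continuous_conj.comp hc) (hσc.mono (hsub hr₃ hr₄)).neg
      (fun r hr => by
        conv_lhs => rw [hlift r (hsub hr₃ hr₄ hr)]
        rw [map_mul, ← Complex.exp_conj]
        simp)
      (fun r hr => by
        rw [← map_mul, Complex.conj_im]
        linarith [hneg r (hsub hr₃ hr₄ hr)])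
    linarith [Real.pi_pos]
  obtain ⟨z, hz, hz0⟩ := isPreconnected_Icc.intermediate_value hs ht hcont.continuousOn ⟨hs0, ht0⟩
  exact hne z hz hz0
end
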